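/- Define the log-canonical thresholds λ_XY = sup({0} ∪ { s > 0 : ∫_{Δ_K × W_b^K} H_XY^{−s} φ < ∞ }) and λ_X = sup({0} ∪ { s > 0 : ∫_{Δ_K × W_b^K} H_X^{−s} φ < ∞ }), which are minus the largest poles of the zeta functions ζ_XY(z) = ∫ H_XY^z φ and ζ_X(z) = ∫ H_X^z φ respectively. Then λ_XY − λ_X ≥ (K − K*)·η₁/2 > 0. (This is the coefficient of (ln n)/n in the lower bound D(n) ≥ ((K−K*)η₁/2)·(ln n)/n + o((ln n)/n) for the Bayes latent-variable estimation error of the mixture model.) -/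

import Mathlib

open MeasureTheory

/-- Read a `Fin n`-indexed vector at a natural-number index (junk value `0` out of range). -/
noncomputable def natIdx {α : Type*} [Zero α] {n : ℕ} (v : Fin n → α) (k : ℕ) : α :=
  if h : k < n then v ⟨k, h⟩ else 0

/-- The mixing-ratio vector `(a_1, …, a_K)` (0-indexed, `K = n+1`) determined by the free
coordinates `u = (a_2, …, a_K)`, via `a_1 = 1 − Σ u`. -/
noncomputable def mixWeights {n : ℕ} (u : Fin n → ℝ) : ℕ → ℝ :=
  natIdx (Fin.cons (1 - ∑ i, u i) u)

/-- The parameter domain `Δ_K × W_b^K` (`K = n+1`), with the simplex `Δ_K` parametrized by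
`(a_2, …, a_K)` carrying `(K−1)`-dimensional Lebesgue measure. -/
def mixDomain {E : Type*} (n : ℕ) (Wb : Set E) : Set ((Fin n → ℝ) × (Fin (n + 1) → E)) :=
  {u : Fin n → ℝ | (∀ i, 0 ≤ u i) ∧ ∑ i, u i ≤ 1} ×ˢ Set.univ.pi fun _ => Wb

/-- The complete-data Kullback–Leibler divergence
`H_XY(a,b) = Σ_{k≤K*} a*_k [ ln(a*_k/a_k) + KLf(b*_k, b_k) ]` (components 0-indexed). -/
noncomputable def mixHXY {E : Type*} [Zero E] (Kstar : ℕ) (astar : ℕ → ℝ)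
    (KLf : ℕ → E → ℝ) {n : ℕ} (w : (Fin n → ℝ) × (Fin (n + 1) → E)) : ℝ :=
  ∑ k ∈ Finset.range Kstar,
    astar k * (Real.log (astar k / mixWeights w.1 k) + KLf k (natIdx w.2 k))

/-- The prior `φ(a,b) = [Γ(Kη₁)/Γ(η₁)^K ∏_k a_k^{η₁−1}] ψ(b)`, `K = n+1`. -/
noncomputable def mixPrior {E : Type*} (η₁ : ℝ) {n : ℕ}
    (ψ : (Fin (n + 1) → E) → ℝ) (w : (Fin n → ℝ) × (Fin (n + 1) → E)) : ℝ :=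
  Real.Gamma ((n + 1 : ℝ) * η₁) / Real.Gamma η₁ ^ (n + 1) *
    (∏ k ∈ Finset.range (n + 1), mixWeights w.1 k ^ (η₁ - 1)) * ψ w.2

/-- Tonelli for a product of nonnegative functions of the separate coordinates. -/
theorem lintegral_fin_prod_eq_prod {α : Type*} [MeasureSpace α] [SigmaFinite (volume : Measure α)]
    {n : ℕ} (g : Fin n → α → ENNReal) (hg : ∀ i, Measurable (g i)) :
    ∫⁻ x : Fin n → α, ∏ i, g i (x i) = ∏ i, ∫⁻ y, g i y := by
  induction n with
  | zero => simp [volume_pi]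
  | succ n ih =>
    have h := (volume_preserving_piFinSuccAbove (fun _ : Fin (n + 1) => α) 0).symm
    rw [← h.lintegral_comp_emb (MeasurableEquiv.measurableEmbedding _)]
    simp_rw [MeasurableEquiv.piFinSuccAbove_symm_apply, Fin.insertNthEquiv,
      Fin.prod_univ_succ, Fin.insertNth_zero]
    simp only [Equiv.coe_fn_mk, Fin.cons_zero, Fin.cons_succ]
    rw [← ih (fun i => g i.succ) fun i => hg i.succ]
    exact lintegral_prod_mul (μ := (volume : Measure α)) (ν := (volume : Measure (Fin n → α)))
      (f := g 0) (g := fun y => ∏ i : Fin n, g i.succ (y i)) (hg 0).aemeasurable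
      (Finset.measurable_fun_prod _ fun i _ =>
        (hg i.succ).comp (measurable_pi_apply i)).aemeasurable

/-- A negative power of the distance to a point, of order below the dimension, has finite
integral over bounded sets. -/
theorem setLIntegral_norm_sub_rpow_neg_lt_top {E : Type*} [NormedAddCommGroup E] [NormedSpace ℝ E]
    [FiniteDimensional ℝ E] [MeasurableSpace E] [BorelSpace E] (ν : Measure E)
    [ν.IsAddHaarMeasure] {p : ℝ} (hp : 0 ≤ p) (hp' : p = 0 ∨ p < Module.finrank ℝ E)
    (c : E) {S : Set E} (hS : Bornology.IsBounded S) :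
    ∫⁻ x in S, ENNReal.ofReal ‖x - c‖ ^ (-p) ∂ν < ⊤ := by
  rcases hp.eq_or_lt with rfl | hp0
  · simpa using hS.measure_lt_top
  have hp'' : p < Module.finrank ℝ E := by
    rcases hp' with h | h
    · exact absurd h hp0.ne'
    · exact h
  have hd : 1 ≤ Module.finrank ℝ E := by
    by_contra h
    have : Module.finrank ℝ E = 0 := by omega
    rw [this] at hp''
    norm_num at hp''
    linarith
  have : Nontrivial E := Module.nontrivial_of_finrank_pos (R := ℝ) hd
  obtain ⟨R, hR⟩ := hS.subset_ball c
  have hmass : IntegrableOn (fun x : E => ‖x‖ ^ (-p)) (Metric.ball 0 R) ν := by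
    refine integrableOn_ball_of_norm_le_rpow (C := 1) hd hp'' ?_ ?_
    · refine Filter.Eventually.of_forall fun x => ?_
      rw [one_mul, Real.norm_of_nonneg (by positivity)]
    · exact (measurable_norm.pow_const _).aestronglyMeasurable
  calc ∫⁻ x in S, ENNReal.ofReal ‖x - c‖ ^ (-p) ∂ν
      ≤ ∫⁻ x in Metric.ball c R, ENNReal.ofReal ‖x - c‖ ^ (-p) ∂ν := lintegral_mono_set hR
    _ = ∫⁻ x in Metric.ball 0 R, ENNReal.ofReal ‖x‖ ^ (-p) ∂ν := by
      have h := (measurePreserving_sub_right ν c).setLIntegral_comp_preimage_emb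
        (MeasurableEquiv.subRight c).measurableEmbedding
        (fun x => ENNReal.ofReal ‖x‖ ^ (-p)) (Metric.ball 0 R)
      rw [← h]
      congr 2
      ext x
      simp [dist_eq_norm]
    _ = ∫⁻ x in Metric.ball 0 R, ENNReal.ofReal (‖x‖ ^ (-p)) ∂ν := by
      refine lintegral_congr_ae (ae_restrict_of_ae ?_)
      filter_upwards [(measure_eq_zero_iff_ae_notMem.1 (measure_singleton (μ := ν) (0 : E)))] with x hx
      rw [ENNReal.ofReal_rpow_of_pos (norm_pos_iff.2 (by simpa using hx))]
    _ < ⊤ := hmass.lintegral_lt_top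

theorem setLIntegral_Icc_rpow_lt_top {r : ℝ} (hr : -1 < r) :
    ∫⁻ x in Set.Icc (0 : ℝ) 1, ENNReal.ofReal (x ^ r) < ⊤ := by
  rw [setLIntegral_congr Ioo_ae_eq_Icc.symm]
  exact ((intervalIntegral.integrableOn_Ioo_rpow_iff zero_lt_one).2 hr).lintegral_lt_top

/-- Tonelli for a product over all barycentric coordinates but the one of index `j.succ`. -/
theorem lintegral_prod_barycentric_succAbove {n : ℕ} (g : ℝ → ENNReal) (hg : Measurable g)
    (j : Fin (n + 1)) :
    ∫⁻ u : Fin (n + 1) → ℝ, g (1 - ∑ i, u i) * ∏ i : Fin n, g (u (j.succAbove i)) =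
      (∫⁻ y, g y) ^ (n + 1) := by
  have h := (volume_preserving_piFinSuccAbove (fun _ : Fin (n + 1) => ℝ) j).symm
  rw [← h.lintegral_comp_emb (MeasurableEquiv.measurableEmbedding _)]
  simp_rw [MeasurableEquiv.piFinSuccAbove_symm_apply, Fin.insertNthEquiv,
    Fin.sum_univ_succAbove _ j]
  simp only [Equiv.coe_fn_mk, Fin.insertNth_apply_same, Fin.insertNth_apply_succAbove]
  rw [Measure.volume_eq_prod, lintegral_prod_symm' _ (by fun_prop)]
  have hin : ∀ y : Fin n → ℝ,
      ∫⁻ x : ℝ, g (1 - (x + ∑ i, y i)) * ∏ i, g (y i) = (∫⁻ x, g x) * ∏ i, g (y i) := by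
    intro y
    rw [lintegral_mul_const _ (by fun_prop)]
    congr 1
    rw [← lintegral_sub_left_eq_self g (1 - ∑ i, y i)]
    congr 1
    ext x
    congr 1
    ring
  simp_rw [hin]
  rw [lintegral_const_mul _ (by fun_prop), lintegral_fin_prod_eq_prod (fun _ => g) fun _ => hg]
  simp [pow_succ']

theorem measurableSet_subprobability (n : ℕ) :
    MeasurableSet {u : Fin n → ℝ | (∀ i, 0 ≤ u i) ∧ ∑ i, u i ≤ 1} := by
  have h : {u : Fin n → ℝ | (∀ i, 0 ≤ u i) ∧ ∑ i, u i ≤ 1} =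
      (⋂ i, {u | 0 ≤ u i}) ∩ {u | ∑ i, u i ≤ 1} := by
    ext u
    simp
  rw [h]
  refine MeasurableSet.inter (MeasurableSet.iInter fun i => ?_) ?_
  · exact measurableSet_le measurable_const (measurable_pi_apply i)
  · exact measurableSet_le
      (Finset.measurable_fun_sum _ fun i _ => measurable_pi_apply i) measurable_const

/-- Finiteness of the Dirichlet integral. -/
theorem setLIntegral_dirichlet_lt_top {n : ℕ} {η : ℝ} (hη : 0 < η) :
    ∫⁻ u in {u : Fin n → ℝ | (∀ i, 0 ≤ u i) ∧ ∑ i, u i ≤ 1},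
      ENNReal.ofReal ((1 - ∑ i, u i) ^ (η - 1)) * ∏ i, ENNReal.ofReal (u i ^ (η - 1)) < ⊤ := by
  have hm := measurableSet_subprobability n
  set g : ℝ → ENNReal := (Set.Icc (0 : ℝ) 1).indicator fun x => ENNReal.ofReal (x ^ (η - 1))
    with hgdef
  have hgm : Measurable g := by
    refine Measurable.indicator ?_ measurableSet_Icc
    fun_prop
  have hgfin : ∫⁻ y, g y < ⊤ := by
    rw [hgdef, lintegral_indicator measurableSet_Icc]
    exact setLIntegral_Icc_rpow_lt_top (by linarith)
  have hgeq : ∀ x ∈ Set.Icc (0 : ℝ) 1, ENNReal.ofReal (x ^ (η - 1)) = g x := fun x hx => by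
    rw [hgdef, Set.indicator_of_mem hx]
  set M : ENNReal := ENNReal.ofReal (max 1 ((1 / (n + 1 : ℝ)) ^ (η - 1))) with hM
  have hMle : ∀ x : ℝ, 1 / (n + 1 : ℝ) ≤ x → x ≤ 1 → ENNReal.ofReal (x ^ (η - 1)) ≤ M := by
    intro x hx hx1
    have hn : (0 : ℝ) < 1 / (n + 1 : ℝ) := by positivity
    refine ENNReal.ofReal_le_ofReal ?_
    rcases le_total 1 η with h | h
    · exact le_max_of_le_left (Real.rpow_le_one (hn.le.trans hx) hx1 (by linarith))
    · exact le_max_of_le_right (Real.rpow_le_rpow_of_nonpos hn hx (by linarith))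
  have hle : ∀ u ∈ {u : Fin n → ℝ | (∀ i, 0 ≤ u i) ∧ ∑ i, u i ≤ 1},
      ENNReal.ofReal ((1 - ∑ i, u i) ^ (η - 1)) * ∏ i, ENNReal.ofReal (u i ^ (η - 1)) ≤
      M * ((∏ i, g (u i)) + ∑ j, g (1 - ∑ i, u i) * ∏ i ∈ Finset.univ.erase j, g (u i)) := by
    rintro u ⟨hu0, hu1⟩
    have hui : ∀ i, u i ≤ 1 := fun i =>
      (Finset.single_le_sum (fun k _ => hu0 k) (Finset.mem_univ i)).trans hu1
    have ha : 1 - ∑ i, u i ∈ Set.Icc (0 : ℝ) 1 :=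
      ⟨by linarith, by linarith [Finset.sum_nonneg fun i (_ : i ∈ Finset.univ) => hu0 i]⟩
    have hp : ∏ i, ENNReal.ofReal (u i ^ (η - 1)) = ∏ i, g (u i) :=
      Finset.prod_congr rfl fun i _ => hgeq _ ⟨hu0 i, hui i⟩
    rw [hp, mul_add]
    by_cases h0 : 1 / (n + 1 : ℝ) ≤ 1 - ∑ i, u i
    · exact le_add_right (mul_le_mul_left (hMle _ h0 ha.2) _)
    · obtain ⟨j, hj⟩ : ∃ j, 1 / (n + 1 : ℝ) ≤ u j := by
        by_contra! hcon
        have h1 : ∑ i, u i ≤ ∑ _i : Fin n, 1 / (n + 1 : ℝ) :=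
          Finset.sum_le_sum fun i _ => (hcon i).le
        have h2 : ∑ _i : Fin n, 1 / (n + 1 : ℝ) = 1 - 1 / (n + 1 : ℝ) := by
          simp only [Finset.sum_const, Finset.card_univ, Fintype.card_fin, nsmul_eq_mul]
          field_simp
          ring
        exact h0 (by linarith)
      refine le_add_left ?_
      rw [hgeq _ ha, ← Finset.mul_prod_erase _ _ (Finset.mem_univ j)]
      have hj' := hMle _ hj (hui j)
      rw [hgeq _ ⟨hu0 j, hui j⟩] at hj'
      calc g (1 - ∑ i, u i) * (g (u j) * ∏ i ∈ Finset.univ.erase j, g (u i))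
          ≤ g (1 - ∑ i, u i) * (M * ∏ i ∈ Finset.univ.erase j, g (u i)) := by gcongr
        _ = M * (g (1 - ∑ i, u i) * ∏ i ∈ Finset.univ.erase j, g (u i)) := by ring
        _ ≤ _ := by
          gcongr
          exact Finset.single_le_sum
            (f := fun j => g (1 - ∑ i, u i) * ∏ i ∈ Finset.univ.erase j, g (u i))
            (fun _ _ => zero_le) (Finset.mem_univ j)
  refine (setLIntegral_mono' hm hle).trans_lt ?_
  refine (setLIntegral_le_lintegral _ _).trans_lt ?_
  rw [lintegral_const_mul _ (by fun_prop), lintegral_add_left (by fun_prop),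
    lintegral_finsetSum _ (fun _ _ => by fun_prop), lintegral_fin_prod_eq_prod (fun _ => g) fun _ => hgm]
  refine ENNReal.mul_lt_top (by simp [hM]) (ENNReal.add_lt_top.2 ⟨?_, ?_⟩)
  · exact ENNReal.prod_lt_top fun _ _ => hgfin
  · refine ENNReal.sum_lt_top.2 fun j _ => ?_
    cases n with
    | zero => exact j.elim0
    | succ m =>
      have hpr : ∀ u : Fin (m + 1) → ℝ, ∏ i ∈ Finset.univ.erase j, g (u i) =
          ∏ i : Fin m, g (u (j.succAbove i)) := by
        intro u
        rw [← Finset.compl_singleton, ← Fin.image_succAbove_univ,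
          Finset.prod_image (fun _ _ _ _ h => Fin.succAbove_right_injective h)]
      simp_rw [hpr]
      rw [lintegral_prod_barycentric_succAbove g hgm j]
      exact ENNReal.pow_lt_top hgfin

theorem sq_sub_sqrt_le_mul_log_div {x y : ℝ} (hx : 0 ≤ x) (hy : 0 < y) :
    (√x - √y) ^ 2 ≤ x * Real.log (x / y) + y - x := by
  rcases hx.eq_or_lt with rfl | hx
  · simp [Real.sq_sqrt hy.le]
  have hsx := Real.sqrt_pos.2 hx
  have hsy := Real.sqrt_pos.2 hy
  have h1 : Real.log (y / x) = 2 * Real.log (√y / √x) := by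
    rw [← Real.sqrt_div hy.le, Real.log_sqrt (by positivity)]
    ring
  have h2 : Real.log (√y / √x) ≤ √y / √x - 1 := Real.log_le_sub_one_of_pos (by positivity)
  have h3 : Real.log (x / y) = - Real.log (y / x) := by rw [← Real.log_inv, inv_div]
  have h4 : x * (√y / √x) = √x * √y := by
    nth_rewrite 1 [← Real.mul_self_sqrt hx.le]
    field_simp
  have h5 := mul_le_mul_of_nonneg_left h2 hx.le
  rw [mul_sub, h4] at h5
  have h6 := Real.sq_sqrt hx.le
  have h7 := Real.sq_sqrt hy.le
  rw [h3, h1]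
  nlinarith

theorem sq_sub_div_four_le_mul_log_div {x y : ℝ} (hx : 0 ≤ x) (hx1 : x ≤ 1) (hy : 0 < y)
    (hy1 : y ≤ 1) : (x - y) ^ 2 / 4 ≤ x * Real.log (x / y) + y - x := by
  refine le_trans ?_ (sq_sub_sqrt_le_mul_log_div hx hy)
  have h1 : x - y = (√x - √y) * (√x + √y) := by
    ring_nf
    rw [Real.sq_sqrt hx, Real.sq_sqrt hy.le]
  have h2 : (√x + √y) ^ 2 ≤ 4 := by
    have := Real.sqrt_le_one.2 hx1
    have := Real.sqrt_le_one.2 hy1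
    nlinarith [Real.sqrt_nonneg x, Real.sqrt_nonneg y]
  rw [h1, mul_pow]
  nlinarith [sq_nonneg (√x - √y)]

/-- The pointwise relative-entropy gap between densities is nonnegative. -/
theorem mul_log_div_add_sub_nonneg {x y : ℝ} (hx : 0 ≤ x) (hy : 0 ≤ y) (hxy : 0 < x → 0 < y) :
    0 ≤ x * Real.log (x / y) + y - x := by
  rcases hx.eq_or_lt with rfl | hx
  · simpa using hy
  · exact (sq_nonneg _).trans (sq_sub_sqrt_le_mul_log_div hx.le (hxy hx))

theorem eq_of_mul_log_div_add_sub_eq_zero {x y : ℝ} (hx : 0 ≤ x) (hy : 0 ≤ y)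
    (hxy : 0 < x → 0 < y) (h : x * Real.log (x / y) + y - x = 0) : x = y := by
  rcases hx.eq_or_lt with rfl | hx
  · simpa using h.symm
  · have h1 := sq_sub_sqrt_le_mul_log_div hx.le (hxy hx)
    rw [h] at h1
    have h2 : √x - √y = 0 := by
      exact pow_eq_zero_iff (two_ne_zero) |>.1 (le_antisymm h1 (sq_nonneg _))
    exact (Real.sqrt_inj hx.le hy).1 (by linarith)

section Gibbs

variable {𝒳 : Type*} [MeasurableSpace 𝒳] {μ : Measure 𝒳} {q p : 𝒳 → ℝ}

theorem integrable_mul_log_div_add_sub (hqi : Integrable q μ) (hpi : Integrable p μ)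
    (hi : Integrable (fun x => q x * Real.log (q x / p x)) μ) :
    Integrable (fun x => q x * Real.log (q x / p x) + p x - q x) μ :=
  (hi.add hpi).sub hqi

theorem integral_mul_log_div_add_sub (hqi : Integrable q μ) (hpi : Integrable p μ)
    (hmass : ∫ x, q x ∂μ = ∫ x, p x ∂μ)
    (hi : Integrable (fun x => q x * Real.log (q x / p x)) μ) :
    ∫ x, (q x * Real.log (q x / p x) + p x - q x) ∂μ =
      ∫ x, q x * Real.log (q x / p x) ∂μ := by
  have h := integral_sub (hi.add hpi) hqi
  simp only [Pi.add_apply] at h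
  rw [h, integral_add hi hpi, hmass, add_sub_cancel_right]

theorem integral_mul_log_div_nonneg (hq0 : ∀ x, 0 ≤ q x) (hp0 : ∀ x, 0 ≤ p x)
    (hqi : Integrable q μ) (hpi : Integrable p μ) (hmass : ∫ x, q x ∂μ = ∫ x, p x ∂μ)
    (hsupp : ∀ᵐ x ∂μ, 0 < q x → 0 < p x) :
    0 ≤ ∫ x, q x * Real.log (q x / p x) ∂μ := by
  by_cases hi : Integrable (fun x => q x * Real.log (q x / p x)) μ
  · have h : 0 ≤ ∫ x, (q x * Real.log (q x / p x) + p x - q x) ∂μ := by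
      refine integral_nonneg_of_ae ?_
      filter_upwards [hsupp] with x hx
      exact mul_log_div_add_sub_nonneg (hq0 x) (hp0 x) hx
    rwa [integral_mul_log_div_add_sub hqi hpi hmass hi] at h
  · rw [integral_undef hi]

theorem ae_eq_of_integral_mul_log_div_eq_zero (hq0 : ∀ x, 0 ≤ q x) (hp0 : ∀ x, 0 ≤ p x)
    (hqi : Integrable q μ) (hpi : Integrable p μ) (hmass : ∫ x, q x ∂μ = ∫ x, p x ∂μ)
    (hsupp : ∀ᵐ x ∂μ, 0 < q x → 0 < p x)
    (hi : Integrable (fun x => q x * Real.log (q x / p x)) μ)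
    (h0 : ∫ x, q x * Real.log (q x / p x) ∂μ = 0) : q =ᵐ[μ] p := by
  have h : ∫ x, (q x * Real.log (q x / p x) + p x - q x) ∂μ = 0 := by
    rw [integral_mul_log_div_add_sub hqi hpi hmass hi, h0]
  rw [integral_eq_zero_iff_of_nonneg_ae ?_ (integrable_mul_log_div_add_sub hqi hpi hi)] at h
  · filter_upwards [hsupp, h] with x hx hx'
    exact eq_of_mul_log_div_add_sub_eq_zero (hq0 x) (hp0 x) hx hx'
  · filter_upwards [hsupp] with x hx
    exact mul_log_div_add_sub_nonneg (hq0 x) (hp0 x) hx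

/-- If `p` dominates a positive multiple of `g`, the relative entropy with respect to `p`
inherits integrability from the one with respect to `g`. -/
theorem integrable_mul_log_div_of_le {g : 𝒳 → ℝ} (hq0 : ∀ x, 0 ≤ q x) (hp0 : ∀ x, 0 ≤ p x)
    (hqi : Integrable q μ) (hpi : Integrable p μ) (hqm : Measurable q) (hpm : Measurable p)
    {c : ℝ} (hc : 0 < c) (hcp : ∀ x, c * g x ≤ p x)
    (hsupp : ∀ᵐ x ∂μ, 0 < q x → 0 < g x)
    (hg : Integrable (fun x => q x * Real.log (q x / g x)) μ) :
    Integrable (fun x => q x * Real.log (q x / p x)) μ := by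
  refine Integrable.mono' (g := fun x => |q x * Real.log (q x / g x)| + |Real.log c| * q x
    + p x + q x) (((hg.abs.add (hqi.const_mul _)).add hpi).add hqi) ?_ ?_
  · exact (hqm.mul (Real.measurable_log.comp (hqm.div hpm))).aestronglyMeasurable
  · filter_upwards [hsupp] with x hx
    rcases (hq0 x).eq_or_lt with h | h
    · simp [← h, hp0 x]
    have hgx := hx h
    have hpx : 0 < p x := lt_of_lt_of_le (by positivity) (hcp x)
    have hlow := mul_log_div_add_sub_nonneg (hq0 x) (hp0 x) fun _ => hpx
    have hup : Real.log (q x / p x) ≤ Real.log (q x / g x) - Real.log c := by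
      rw [← Real.log_div (by positivity) hc.ne']
      refine Real.log_le_log (by positivity) ?_
      rw [div_div]
      have := hcp x
      gcongr
      linarith
    have hup' := mul_le_mul_of_nonneg_left hup (hq0 x)
    rw [Real.norm_eq_abs, abs_le]
    have h1 := le_abs_self (q x * Real.log (q x / g x))
    have h2 := abs_nonneg (q x * Real.log (q x / g x))
    have h3 := mul_nonneg (abs_nonneg (Real.log c)) (hq0 x)
    have h4 := mul_le_mul_of_nonneg_right (neg_abs_le (Real.log c)) (hq0 x)
    have h5 := hp0 x
    constructor <;> nlinarith

/-- A density `g` whose mixtures with `q` have uniformly bounded relative entropy dominates `q`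
and has integrable relative entropy itself. -/
theorem ae_pos_and_integrable_of_mixture_bound {g : 𝒳 → ℝ} (hq0 : ∀ x, 0 ≤ q x)
    (hg0 : ∀ x, 0 ≤ g x) (hqi : Integrable q μ) (hgi : Integrable g μ) (hqm : Measurable q)
    (hgm : Measurable g) (hmass : ∫ x, q x ∂μ = ∫ x, g x ∂μ) {D : ℝ}
    (hD : ∀ ε : ℝ, 0 < ε → ε < 1 →
      ∫ x, q x * Real.log (q x / (ε * q x + (1 - ε) * g x)) ∂μ ≤ D) :
    (∀ᵐ x ∂μ, 0 < q x → 0 < g x) ∧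
      Integrable (fun x => q x * Real.log (q x / g x)) μ := by
  set P : ℝ → 𝒳 → ℝ := fun ε x => ε * q x + (1 - ε) * g x with hP
  set G : ℝ → 𝒳 → ℝ := fun ε x => q x * Real.log (q x / P ε x) + P ε x - q x with hG
  have hP0 : ∀ ε, 0 < ε → ε < 1 → ∀ x, 0 ≤ P ε x := fun ε h0 h1 x =>
    add_nonneg (mul_nonneg h0.le (hq0 x)) (mul_nonneg (by linarith) (hg0 x))
  have hPq : ∀ ε, 0 < ε → ε < 1 → ∀ x, ε * q x ≤ P ε x := fun ε h0 h1 x =>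
    le_add_of_nonneg_right (mul_nonneg (by linarith) (hg0 x))
  have hPm : ∀ ε, Measurable (P ε) := fun ε => by fun_prop
  have hPi : ∀ ε, Integrable (P ε) μ := fun ε => (hqi.const_mul _).add (hgi.const_mul _)
  have hPint : ∀ ε, ∫ x, P ε x ∂μ = ∫ x, q x ∂μ := fun ε => by
    rw [hP, integral_add (hqi.const_mul _) (hgi.const_mul _), integral_const_mul,
      integral_const_mul, ← hmass]
    ring
  have hLi : ∀ ε, 0 < ε → ε < 1 → Integrable (fun x => q x * Real.log (q x / P ε x)) μ := by
    intro ε h0 h1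
    refine integrable_mul_log_div_of_le (g := q) hq0 (hP0 ε h0 h1) hqi (hPi ε) hqm (hPm ε) h0
      (hPq ε h0 h1) (Filter.Eventually.of_forall fun x h => h) ?_
    have : (fun x => q x * Real.log (q x / q x)) = fun _ => (0 : ℝ) := by
      ext x
      by_cases h : q x = 0 <;> simp [h]
    rw [this]
    exact integrable_zero _ _ _
  have hG0 : ∀ ε, 0 < ε → ε < 1 → ∀ x, 0 ≤ G ε x := fun ε h0 h1 x =>
    mul_log_div_add_sub_nonneg (hq0 x) (hP0 ε h0 h1 x)
      fun h => lt_of_lt_of_le (by positivity) (hPq ε h0 h1 x)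
  have hGi : ∀ ε, 0 < ε → ε < 1 → Integrable (G ε) μ := fun ε h0 h1 =>
    ((hLi ε h0 h1).add (hPi ε)).sub hqi
  have hGD : ∀ ε, 0 < ε → ε < 1 → ∫ x, G ε x ∂μ ≤ D := fun ε h0 h1 => by
    rw [hG, integral_mul_log_div_add_sub hqi (hPi ε) (hPint ε).symm (hLi ε h0 h1)]
    exact hD ε h0 h1
  have hsupp : ∀ᵐ x ∂μ, 0 < q x → 0 < g x := by
    have hB : MeasurableSet {x | g x = 0} := hgm (measurableSet_singleton 0)
    have hzero : ∫ x in {x | g x = 0}, q x ∂μ = 0 := by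
      refine le_antisymm ?_ (integral_nonneg fun x => hq0 x)
      by_contra! hpos
      set m := ∫ x in {x | g x = 0}, q x ∂μ with hm
      have key : ∀ ε, 0 < ε → ε < 1 → (-Real.log ε - 1) * m ≤ D := by
        intro ε h0 h1
        refine le_trans ?_ (hGD ε h0 h1)
        rw [hm, ← integral_const_mul]
        refine le_trans ?_ (setIntegral_le_integral (s := {x | g x = 0}) (hGi ε h0 h1)
          (Filter.Eventually.of_forall (hG0 ε h0 h1)))
        refine setIntegral_mono_on (hqi.const_mul _).integrableOn (hGi ε h0 h1).integrableOn hB ?_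
        intro x hx
        have hx' : g x = 0 := hx
        rcases (hq0 x).eq_or_lt with h | h
        · simp [hG, hP, ← h, hx']
        · have : q x / P ε x = ε⁻¹ := by
            simp only [hP, hx', mul_zero, add_zero]
            field_simp
          simp only [hG, this, Real.log_inv]
          have := hP0 ε h0 h1 x
          nlinarith
      have hε := key (Real.exp (-((|D| + 1) / m + 1))) (Real.exp_pos _) (by
        rw [Real.exp_lt_one_iff]
        have : 0 ≤ (|D| + 1) / m := by positivity
        linarith)
      rw [Real.log_exp, neg_neg, add_sub_cancel_right, div_mul_cancel₀ _ hpos.ne'] at hε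
      linarith [le_abs_self D]
    rw [integral_eq_zero_iff_of_nonneg (fun x => hq0 x) hqi.integrableOn] at hzero
    have h := (ae_restrict_iff' hB).1 hzero
    filter_upwards [h] with x hx hqx
    refine (hg0 x).lt_of_ne fun h0 => ?_
    exact hqx.ne' (hx h0.symm)
  refine ⟨hsupp, ?_⟩
  set e : ℕ → ℝ := fun n => 1 / ((n : ℝ) + 2) with he
  have he0 : ∀ n, 0 < e n := fun n => by positivity
  have he1 : ∀ n, e n < 1 := fun n => by
    rw [he]
    simp only
    rw [div_lt_one (by positivity)]
    linarith [(Nat.cast_nonneg n : (0 : ℝ) ≤ n)]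
  have hel : Filter.Tendsto e Filter.atTop (nhds 0) := by
    have := (tendsto_one_div_add_atTop_nhds_zero_nat (𝕜 := ℝ)).comp (Filter.tendsto_add_atTop_nat 1)
    refine this.congr fun n => ?_
    simp [he]
    ring
  have hGm : ∀ ε, Measurable (G ε) := fun ε =>
    ((hqm.mul (Real.measurable_log.comp (hqm.div (hPm ε)))).add (hPm ε)).sub hqm
  have hlim : ∀ᵐ x ∂μ, Filter.Tendsto (fun n => G (e n) x) Filter.atTop
      (nhds (q x * Real.log (q x / g x) + g x - q x)) := by
    filter_upwards [hsupp] with x hx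
    have hPl : Filter.Tendsto (fun n => P (e n) x) Filter.atTop (nhds (g x)) := by
      have : Filter.Tendsto (fun n => e n * q x + (1 - e n) * g x) Filter.atTop
          (nhds (0 * q x + (1 - 0) * g x)) :=
        (hel.mul_const _).add ((tendsto_const_nhds.sub hel).mul_const _)
      simpa using this
    refine Filter.Tendsto.sub (Filter.Tendsto.add ?_ hPl) tendsto_const_nhds
    rcases (hq0 x).eq_or_lt with h | h
    · simp [← h]
    · have hgx := hx h
      exact (Filter.Tendsto.log (tendsto_const_nhds.div hPl hgx.ne') (by positivity)).const_mul _
  have hfin : Integrable (fun x => q x * Real.log (q x / g x) + g x - q x) μ := by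
    refine ⟨(((hqm.mul (Real.measurable_log.comp (hqm.div hgm))).add hgm).sub
      hqm).aestronglyMeasurable, ?_⟩
    rw [hasFiniteIntegral_iff_ofReal (by
      filter_upwards [hsupp] with x hx
      exact mul_log_div_add_sub_nonneg (hq0 x) (hg0 x) hx)]
    calc ∫⁻ x, ENNReal.ofReal (q x * Real.log (q x / g x) + g x - q x) ∂μ
        = ∫⁻ x, Filter.liminf (fun n => ENNReal.ofReal (G (e n) x)) Filter.atTop ∂μ := by
          refine lintegral_congr_ae ?_
          filter_upwards [hlim] with x hx
          exact ((ENNReal.continuous_ofReal.tendsto _).comp hx).liminf_eq.symm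
      _ ≤ Filter.liminf (fun n => ∫⁻ x, ENNReal.ofReal (G (e n) x) ∂μ) Filter.atTop :=
          lintegral_liminf_le fun n => (hGm _).ennreal_ofReal
      _ ≤ Filter.liminf (fun _ : ℕ => ENNReal.ofReal D) Filter.atTop := by
          refine Filter.liminf_le_liminf (Filter.Eventually.of_forall fun n => ?_)
          rw [← ofReal_integral_eq_lintegral_ofReal (hGi _ (he0 n) (he1 n))
            (Filter.Eventually.of_forall (hG0 _ (he0 n) (he1 n)))]
          exact ENNReal.ofReal_le_ofReal (hGD _ (he0 n) (he1 n))
      _ < ⊤ := by simp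
  have h := (hfin.sub hgi).add hqi
  refine h.congr (Filter.Eventually.of_forall fun x => ?_)
  simp only [Pi.add_apply, Pi.sub_apply]
  ring

end Gibbs

section MixWeights

variable {n : ℕ}

theorem natIdx_of_lt {α : Type*} [Zero α] (v : Fin n → α) {k : ℕ} (h : k < n) :
    natIdx v k = v ⟨k, h⟩ := dif_pos h

theorem mixWeights_zero (u : Fin n → ℝ) : mixWeights u 0 = 1 - ∑ i, u i := by
  rw [mixWeights, natIdx_of_lt _ n.succ_pos]
  rfl

theorem mixWeights_succ (u : Fin n → ℝ) (i : Fin n) : mixWeights u (i + 1) = u i := by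
  rw [mixWeights, natIdx_of_lt _ (Nat.succ_lt_succ i.2)]
  rfl

theorem sum_range_succ_eq_fin {M : Type*} [AddCommMonoid M] (g : ℕ → M) :
    ∑ k ∈ Finset.range (n + 1), g k = g 0 + ∑ i : Fin n, g (i + 1) := by
  rw [Finset.sum_range_succ', add_comm, Finset.sum_range fun k => g (k + 1)]

theorem prod_range_succ_eq_fin {M : Type*} [CommMonoid M] (g : ℕ → M) :
    ∏ k ∈ Finset.range (n + 1), g k = g 0 * ∏ i : Fin n, g (i + 1) := by
  rw [Finset.prod_range_succ', mul_comm, Finset.prod_range fun k => g (k + 1)]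

theorem sum_mixWeights (u : Fin n → ℝ) : ∑ k ∈ Finset.range (n + 1), mixWeights u k = 1 := by
  rw [sum_range_succ_eq_fin, mixWeights_zero]
  simp_rw [mixWeights_succ]
  ring

theorem mixWeights_nonneg {u : Fin n → ℝ} (hu : (∀ i, 0 ≤ u i) ∧ ∑ i, u i ≤ 1) (k : ℕ) :
    0 ≤ mixWeights u k := by
  rcases k with _ | k
  · rw [mixWeights_zero]
    linarith [hu.2]
  · by_cases hk : k < n
    · exact (mixWeights_succ u ⟨k, hk⟩).symm ▸ hu.1 ⟨k, hk⟩
    · simp [mixWeights, natIdx, hk]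

theorem mixWeights_le_one {u : Fin n → ℝ} (hu : (∀ i, 0 ≤ u i) ∧ ∑ i, u i ≤ 1) {k : ℕ}
    (hk : k < n + 1) : mixWeights u k ≤ 1 := by
  rw [← sum_mixWeights u]
  exact Finset.single_le_sum (f := mixWeights u) (fun k _ => mixWeights_nonneg hu k)
    (Finset.mem_range.2 hk)

theorem measurableSet_mixDomain {E : Type*} [MeasurableSpace E] {Wb : Set E}
    (hWb : MeasurableSet Wb) : MeasurableSet (mixDomain n Wb) :=
  (measurableSet_subprobability n).prod (MeasurableSet.univ_pi fun _ => hWb)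

theorem prod_range_ite_lt {M : Type*} [CommMonoid M] (x y : M) {k m : ℕ} (hk : k ≤ m) :
    ∏ i ∈ Finset.range m, (if i < k then x else y) = x ^ k * y ^ (m - k) := by
  obtain ⟨l, rfl⟩ := Nat.exists_eq_add_of_le hk
  rw [Finset.prod_range_add]
  congr 1
  · rw [Finset.prod_congr rfl fun i hi => if_pos (Finset.mem_range.1 hi)]
    simp
  · simp

end MixWeights

theorem min_rpow_le_rpow {m M y r : ℝ} (hm : 0 < m) (hmy : m ≤ y) (hyM : y ≤ M) :
    min (m ^ r) (M ^ r) ≤ y ^ r := by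
  rcases le_total 0 r with h | h
  · exact (min_le_left _ _).trans (Real.rpow_le_rpow hm.le hmy h)
  · exact (min_le_right _ _).trans (Real.rpow_le_rpow_of_nonpos (hm.trans_le hmy) hyM h)

/-- Free coordinates of the true mixing weights, padded by zero. -/
noncomputable def trueWeights (Kstar : ℕ) (astar : ℕ → ℝ) {n : ℕ} (i : Fin n) : ℝ :=
  if (i : ℕ) + 1 < Kstar then astar (i + 1) else 0

/-- A box of size `τ` shrinking towards the true parameter in the direction `(α, v)`; the
positions of the redundant components stay free in a fixed ball. -/
noncomputable def mixBox {d n : ℕ} (Kstar : ℕ) (astar : ℕ → ℝ)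
    (bstar : ℕ → EuclideanSpace ℝ (Fin d)) (α : Fin n → ℝ) (v : ℕ → EuclideanSpace ℝ (Fin d))
    (β r τ : ℝ) : Set ((Fin n → ℝ) × (Fin (n + 1) → EuclideanSpace ℝ (Fin d))) :=
  (Set.univ.pi fun i => Set.Icc (trueWeights Kstar astar i + α i * τ)
      (trueWeights Kstar astar i + (α i + β) * τ)) ×ˢ
    Set.univ.pi fun k : Fin (n + 1) => if (k : ℕ) < Kstar then
      Metric.closedBall (bstar k + τ • v k) (β * τ) else Metric.closedBall (bstar 0) r

section Box

variable {d n : ℕ} {Kstar : ℕ} {astar : ℕ → ℝ} {bstar : ℕ → EuclideanSpace ℝ (Fin d)}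
  {α : Fin n → ℝ} {v : ℕ → EuclideanSpace ℝ (Fin d)} {β r : ℝ}

theorem measurableSet_mixBox (τ : ℝ) :
    MeasurableSet (mixBox Kstar astar bstar α v β r τ) := by
  refine MeasurableSet.prod (MeasurableSet.univ_pi fun i => measurableSet_Icc)
    (MeasurableSet.univ_pi fun k => ?_)
  split_ifs <;> exact Metric.isClosed_closedBall.measurableSet

theorem sum_trueWeights (hKstar : 1 ≤ Kstar) (hKlt : Kstar ≤ n)
    (hastar_sum : ∑ k ∈ Finset.range Kstar, astar k = 1) :
    ∑ i : Fin n, trueWeights Kstar astar i = 1 - astar 0 := by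
  have h : ∑ k ∈ Finset.range (n + 1), (if k < Kstar then astar k else 0) = 1 := by
    rw [← hastar_sum, ← Finset.sum_filter]
    refine Finset.sum_congr ?_ fun _ _ => rfl
    ext k
    simp only [Finset.mem_filter, Finset.mem_range]
    omega
  rw [sum_range_succ_eq_fin, if_pos (by omega)] at h
  simp only [trueWeights]
  linarith

/-- Uniform control of a point of the box, for all small sizes. -/
theorem exists_mixBox_bounds (hKstar : 1 ≤ Kstar) (hKlt : Kstar ≤ n)
    (hastar_pos : ∀ k < Kstar, 0 < astar k)
    (hastar_sum : ∑ k ∈ Finset.range Kstar, astar k = 1)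
    {Wb : Set (EuclideanSpace ℝ (Fin d))} (hbstar : ∀ k < Kstar, bstar k ∈ interior Wb)
    (hr : Metric.closedBall (bstar 0) r ⊆ Wb) (hβ : 0 < β) (hα : ∀ i, 0 ≤ α i) :
    ∃ M > 0, ∃ τ₀ > 0, ∀ τ, 0 < τ → τ < τ₀ → ∀ w ∈ mixBox Kstar astar bstar α v β r τ,
      w ∈ mixDomain n Wb ∧ (∀ k < Kstar, astar k / 2 ≤ mixWeights w.1 k) ∧
      (∀ k < Kstar, |mixWeights w.1 k - astar k| ≤ M * τ) ∧
      (∀ k < Kstar, ‖natIdx w.2 k - bstar k‖ ≤ M * τ) ∧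
      (∀ i, |w.1 i - trueWeights Kstar astar i| ≤ M * τ) := by
  set A := ∑ i, α i with hA
  have hαA : ∀ i, α i ≤ A := fun i =>
    Finset.single_le_sum (fun i _ => hα i) (Finset.mem_univ i)
  set V := ∑ k ∈ Finset.range Kstar, ‖v k‖ with hV
  have hvV : ∀ k < Kstar, ‖v k‖ ≤ V := fun k hk =>
    Finset.single_le_sum (f := fun k => ‖v k‖) (fun i _ => norm_nonneg _) (Finset.mem_range.2 hk)
  have hA0 : 0 ≤ A := Finset.sum_nonneg fun i _ => hα i
  have hV0 : 0 ≤ V := Finset.sum_nonneg fun i _ => norm_nonneg _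
  set M := (n + 1 : ℝ) * (A + β) + V + β with hM
  have hMpos : 0 < M := by positivity
  have hAM : A + β ≤ M := by
    have : 0 ≤ (n : ℝ) * (A + β) := by positivity
    nlinarith
  obtain ⟨m, hm0, hm⟩ : ∃ m > 0, ∀ k < Kstar, m ≤ astar k := by
    have hne : (Finset.range Kstar).Nonempty := ⟨0, Finset.mem_range.2 (by omega)⟩
    refine ⟨(Finset.range Kstar).inf' hne astar, ?_, fun k hk =>
      Finset.inf'_le _ (Finset.mem_range.2 hk)⟩
    exact (Finset.lt_inf'_iff _).2 fun k hk => hastar_pos k (Finset.mem_range.1 hk)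
  obtain ⟨δ, hδ0, hδ⟩ : ∃ δ > 0, ∀ k < Kstar, Metric.closedBall (bstar k) δ ⊆ Wb := by
    have h : ∀ k : Fin Kstar, ∃ δ > 0, Metric.closedBall (bstar k) δ ⊆ Wb := fun k =>
      Metric.nhds_basis_closedBall.mem_iff.1 (mem_interior_iff_mem_nhds.1 (hbstar k k.2))
    choose δ hδ0 hδ using h
    have hne : (Finset.univ : Finset (Fin Kstar)).Nonempty := ⟨⟨0, by omega⟩, Finset.mem_univ _⟩
    refine ⟨Finset.univ.inf' hne δ, (Finset.lt_inf'_iff _).2 fun k _ => hδ0 k, fun k hk => ?_⟩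
    exact (Metric.closedBall_subset_closedBall
      (Finset.inf'_le δ (Finset.mem_univ (⟨k, hk⟩ : Fin Kstar)))).trans (hδ ⟨k, hk⟩)
  refine ⟨M, hMpos, min (m / 2 / M) (δ / M), by positivity, fun τ hτ hτ0 w hw => ?_⟩
  have hτm : M * τ ≤ m / 2 := by
    have := (hτ0.trans_le (min_le_left _ _)).le
    rwa [le_div_iff₀ hMpos, mul_comm] at this
  have hτδ : M * τ ≤ δ := by
    have := (hτ0.trans_le (min_le_right _ _)).le
    rwa [le_div_iff₀ hMpos, mul_comm] at this
  obtain ⟨hw1, hw2⟩ := hw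
  simp only [Set.mem_univ_pi] at hw1 hw2
  have hu0 : ∀ i, 0 ≤ w.1 i - trueWeights Kstar astar i := fun i => by
    have := (hw1 i).1
    have := mul_nonneg (hα i) hτ.le
    linarith
  have hu1 : ∀ i, w.1 i - trueWeights Kstar astar i ≤ (A + β) * τ := fun i => by
    have h1 := (hw1 i).2
    have h2 := mul_le_mul_of_nonneg_right (hαA i) hτ.le
    linarith
  have hu : ∀ i, |w.1 i - trueWeights Kstar astar i| ≤ M * τ := fun i => by
    rw [abs_of_nonneg (hu0 i)]
    exact (hu1 i).trans (mul_le_mul_of_nonneg_right hAM hτ.le)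
  have hsum : ∑ i, (w.1 i - trueWeights Kstar astar i) ≤ M * τ := by
    calc ∑ i, (w.1 i - trueWeights Kstar astar i) ≤ ∑ _i : Fin n, (A + β) * τ :=
          Finset.sum_le_sum fun i _ => hu1 i
      _ = n * (A + β) * τ := by simp; ring
      _ ≤ M * τ := by
          refine mul_le_mul_of_nonneg_right ?_ hτ.le
          rw [hM]
          nlinarith
  have hsum0 : 0 ≤ ∑ i, (w.1 i - trueWeights Kstar astar i) := Finset.sum_nonneg fun i _ => hu0 i
  rw [Finset.sum_sub_distrib, sum_trueWeights hKstar hKlt hastar_sum] at hsum hsum0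
  have habs : ∀ k < Kstar, |mixWeights w.1 k - astar k| ≤ M * τ := by
    intro k hk
    rcases k with _ | k
    · rw [mixWeights_zero, abs_le]
      constructor <;> linarith
    · have := hu ⟨k, by omega⟩
      rw [mixWeights_succ w.1 ⟨k, by omega⟩]
      simpa [trueWeights, hk] using this
  have hhalf : ∀ k < Kstar, astar k / 2 ≤ mixWeights w.1 k := fun k hk => by
    have h1 := (abs_le.1 (habs k hk)).1
    have h2 := hm k hk
    linarith
  have hb : ∀ k < Kstar, ‖natIdx w.2 k - bstar k‖ ≤ M * τ := by
    intro k hk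
    have h := hw2 ⟨k, by omega⟩
    simp only [hk, if_true, Metric.mem_closedBall, dist_eq_norm] at h
    rw [natIdx_of_lt w.2 (by omega : k < n + 1)]
    have h1 : w.2 ⟨k, by omega⟩ - bstar k =
        (w.2 ⟨k, by omega⟩ - (bstar k + τ • v k)) + τ • v k := by abel
    rw [h1]
    refine (norm_add_le _ _).trans ?_
    rw [norm_smul, Real.norm_of_nonneg hτ.le]
    have h2 := mul_le_mul_of_nonneg_left (hvV k hk) hτ.le
    have h3 : 0 ≤ (n + 1 : ℝ) * (A + β) * τ := by positivity
    rw [hM]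
    nlinarith
  refine ⟨⟨⟨fun i => ?_, ?_⟩, ?_⟩, hhalf, habs, hb, hu⟩
  · have h1 := hu0 i
    have h2 : 0 ≤ trueWeights Kstar astar i := by
      rw [trueWeights]
      split_ifs with h
      · exact (hastar_pos _ h).le
      · exact le_rfl
    linarith
  · have h1 := hhalf 0 (by omega)
    have h2 := hastar_pos 0 (by omega)
    rw [mixWeights_zero] at h1
    linarith
  · simp only [Set.mem_univ_pi]
    intro k
    by_cases hk : (k : ℕ) < Kstar
    · refine hδ k hk ?_
      rw [Metric.mem_closedBall, dist_eq_norm]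
      have := hb k hk
      rw [natIdx_of_lt w.2 k.2] at this
      exact this.trans hτδ
    · have := hw2 k
      rw [if_neg hk] at this
      exact hr this

theorem exists_le_volume_mixBox (hKlt : Kstar ≤ n) (hβ : 0 < β) (hr : 0 < r) :
    ∃ c > 0, ∀ τ, 0 < τ → ENNReal.ofReal (c * τ ^ ((n : ℝ) + Kstar * d)) ≤
      volume (mixBox Kstar astar bstar α v β r τ) := by
  set V := (volume (Metric.ball (0 : EuclideanSpace ℝ (Fin d)) 1)).toReal with hV
  have hVtop : volume (Metric.ball (0 : EuclideanSpace ℝ (Fin d)) 1) ≠ ⊤ :=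
    measure_ball_lt_top.ne
  have hV0 : 0 < V := ENNReal.toReal_pos (Metric.measure_ball_pos _ _ one_pos).ne' hVtop
  have hball : ∀ (x : EuclideanSpace ℝ (Fin d)) {ρ : ℝ}, 0 ≤ ρ →
      volume (Metric.closedBall x ρ) = ENNReal.ofReal (ρ ^ d * V) := fun x ρ hρ => by
    rw [Measure.addHaar_closedBall _ x hρ, ENNReal.ofReal_mul (by positivity), hV,
      ENNReal.ofReal_toReal hVtop]
    simp
  refine ⟨β ^ n * ((β ^ d * V) ^ Kstar * (r ^ d * V) ^ (n + 1 - Kstar)), by positivity,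
    fun τ hτ => ?_⟩
  rw [mixBox, Measure.volume_eq_prod, Measure.prod_prod, volume_pi, volume_pi, Measure.pi_pi,
    Measure.pi_pi]
  have h1 : ∀ i : Fin n, volume (Set.Icc (trueWeights Kstar astar i + α i * τ)
      (trueWeights Kstar astar i + (α i + β) * τ)) = ENNReal.ofReal (β * τ) := fun i => by
    rw [Real.volume_Icc]
    congr 1
    ring
  have h2 : ∀ k : Fin (n + 1), volume (if (k : ℕ) < Kstar then
      Metric.closedBall (bstar k + τ • v k) (β * τ) else Metric.closedBall (bstar 0) r) =
      ENNReal.ofReal (if (k : ℕ) < Kstar then (β * τ) ^ d * V else r ^ d * V) := fun k => by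
    split_ifs
    · exact hball _ (by positivity)
    · exact hball _ hr.le
  simp_rw [h1, h2]
  rw [← ENNReal.ofReal_prod_of_nonneg fun _ _ => by positivity,
    ← ENNReal.ofReal_prod_of_nonneg fun _ _ => by split_ifs <;> positivity,
    ← ENNReal.ofReal_mul (by positivity),
    ← Finset.prod_range fun k => if k < Kstar then (β * τ) ^ d * V else r ^ d * V,
    prod_range_ite_lt _ _ (by omega)]
  refine ENNReal.ofReal_le_ofReal (le_of_eq ?_)
  have h3 : τ ^ ((n : ℝ) + Kstar * d) = τ ^ n * (τ ^ d) ^ Kstar := by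
    rw [← pow_mul, ← pow_add, ← Real.rpow_natCast]
    push_cast
    rw [mul_comm (d : ℝ)]
  rw [h3]
  simp only [Finset.prod_const, Finset.card_univ, Fintype.card_fin, mul_pow]
  ring

end Box

section Divergence

variable {d n : ℕ} {Kstar : ℕ} {astar : ℕ → ℝ} {bstar : ℕ → EuclideanSpace ℝ (Fin d)}
  {α : Fin n → ℝ} {v : ℕ → EuclideanSpace ℝ (Fin d)} {β r η : ℝ}
  {Wb : Set (EuclideanSpace ℝ (Fin d))} {ψ : (Fin (n + 1) → EuclideanSpace ℝ (Fin d)) → ℝ}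

/-- Lower bound for the prior density on a small box. -/
theorem exists_le_mixPrior_mixBox (hKstar : 1 ≤ Kstar) (hKlt : Kstar ≤ n)
    (hastar_pos : ∀ k < Kstar, 0 < astar k)
    (hastar_sum : ∑ k ∈ Finset.range Kstar, astar k = 1) (hWb : IsCompact Wb)
    (hbstar : ∀ k < Kstar, bstar k ∈ interior Wb)
    (hr : Metric.closedBall (bstar 0) r ⊆ Wb) (hβ : 0 < β) (hα : ∀ i, 0 ≤ α i)
    (hα_pos : ∀ i : Fin n, Kstar ≤ i + 1 → 0 < α i) (hη : 0 < η)
    (hψ_cont : ContinuousOn ψ (Set.univ.pi fun _ => Wb))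
    (hψ_pos : ∀ b ∈ Set.univ.pi fun _ => Wb, 0 < ψ b) :
    ∃ c > 0, ∃ τ₀ > 0, ∀ τ, 0 < τ → τ < τ₀ → ∀ w ∈ mixBox Kstar astar bstar α v β r τ,
      c * τ ^ ((n + 1 - Kstar : ℝ) * (η - 1)) ≤ mixPrior η ψ w := by
  obtain ⟨M, -, τ₀, hτ₀, hbox⟩ := exists_mixBox_bounds (v := v) hKstar hKlt hastar_pos
    hastar_sum hbstar hr hβ hα
  obtain ⟨m, hm0, hm⟩ : ∃ m > 0, ∀ b ∈ Set.univ.pi fun _ : Fin (n + 1) => Wb, m ≤ ψ b := by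
    have hcomp : IsCompact (Set.univ.pi fun _ : Fin (n + 1) => Wb) :=
      isCompact_univ_pi fun _ => hWb
    have hne : (Set.univ.pi fun _ : Fin (n + 1) => Wb).Nonempty :=
      ⟨fun _ => bstar 0, fun _ _ => interior_subset (hbstar 0 hKstar)⟩
    obtain ⟨b, hb, hmin⟩ := hcomp.exists_isMinOn hne hψ_cont
    exact ⟨ψ b, hψ_pos b hb, fun b' hb' => hmin hb'⟩
  have hfactor : ∀ k : ℕ, ∃ e > 0, k < n + 1 → ∀ τ, 0 < τ → τ < τ₀ →
      ∀ w ∈ mixBox Kstar astar bstar α v β r τ,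
      e * (if k < Kstar then 1 else τ ^ (η - 1)) ≤ mixWeights w.1 k ^ (η - 1) := by
    intro k
    by_cases hk : k < Kstar
    · have ha := hastar_pos k hk
      refine ⟨min ((astar k / 2) ^ (η - 1)) (1 ^ (η - 1)),
        lt_min (Real.rpow_pos_of_pos (by positivity) _) (by simp), fun hkn τ hτ hτ' w hw => ?_⟩
      obtain ⟨hdom, hhalf, -⟩ := hbox τ hτ hτ' w hw
      rw [if_pos hk, mul_one]
      exact min_rpow_le_rpow (by positivity) (hhalf k hk) (mixWeights_le_one hdom.1 hkn)
    · by_cases hkn : k < n + 1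
      · obtain ⟨i, rfl⟩ : ∃ i : Fin n, k = i + 1 :=
          ⟨⟨k - 1, by omega⟩, by simp only; omega⟩
        have hi := hα_pos i (by omega)
        refine ⟨min (α i ^ (η - 1)) ((α i + β) ^ (η - 1)),
          lt_min (Real.rpow_pos_of_pos hi _) (Real.rpow_pos_of_pos (by positivity) _),
          fun _ τ hτ hτ' w hw => ?_⟩
        rw [if_neg hk, mixWeights_succ]
        have h1 := (hw.1 i (Set.mem_univ i))
        simp only [trueWeights, hk, if_false, zero_add, Set.mem_Icc] at h1
        have h2 : w.1 i = w.1 i / τ * τ := by field_simp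
        have h3 : α i ≤ w.1 i / τ := (le_div_iff₀ hτ).2 h1.1
        have h4 : w.1 i / τ ≤ α i + β := (div_le_iff₀ hτ).2 h1.2
        rw [h2, Real.mul_rpow (hi.le.trans h3) hτ.le]
        exact mul_le_mul_of_nonneg_right (min_rpow_le_rpow hi h3 h4) (by positivity)
      · exact ⟨1, one_pos, fun h => absurd h hkn⟩
  choose e he0 he using hfactor
  have hΓ : 0 < Real.Gamma ((n + 1 : ℝ) * η) / Real.Gamma η ^ (n + 1) :=
    div_pos (Real.Gamma_pos_of_pos (by positivity)) (pow_pos (Real.Gamma_pos_of_pos hη) _)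
  set Γ := Real.Gamma ((n + 1 : ℝ) * η) / Real.Gamma η ^ (n + 1) with hΓdef
  have he' : 0 < ∏ k ∈ Finset.range (n + 1), e k := Finset.prod_pos fun k _ => he0 k
  refine ⟨Γ * (∏ k ∈ Finset.range (n + 1), e k) * m, by positivity, τ₀, hτ₀,
    fun τ hτ hτ' w hw => ?_⟩
  have hexp : τ ^ ((n + 1 - Kstar : ℝ) * (η - 1)) = (τ ^ (η - 1)) ^ (n + 1 - Kstar) := by
    rw [mul_comm, Real.rpow_mul hτ.le, ← Real.rpow_natCast]
    congr 1
    rw [Nat.cast_sub (by omega)]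
    push_cast
    ring
  have hprod : (∏ k ∈ Finset.range (n + 1), e k) * (τ ^ (η - 1)) ^ (n + 1 - Kstar) ≤
      ∏ k ∈ Finset.range (n + 1), mixWeights w.1 k ^ (η - 1) := by
    have h := prod_range_ite_lt (1 : ℝ) (τ ^ (η - 1)) (show Kstar ≤ n + 1 by omega)
    rw [one_pow, one_mul] at h
    rw [← h, ← Finset.prod_mul_distrib]
    refine Finset.prod_le_prod (fun k _ => mul_nonneg (he0 k).le ?_) fun k hk =>
      he k (Finset.mem_range.1 hk) τ hτ hτ' w hw
    split_ifs <;> positivity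
  rw [hexp, mixPrior, ← hΓdef]
  calc _ = Γ * ((∏ k ∈ Finset.range (n + 1), e k) * (τ ^ (η - 1)) ^ (n + 1 - Kstar)) * m := by
        ring
    _ ≤ _ := mul_le_mul (mul_le_mul_of_nonneg_left hprod hΓ.le)
        (hm _ (hbox τ hτ hτ' w hw).1.2) hm0.le
        (mul_nonneg hΓ.le (hprod.trans' (by positivity)))

/-- An integrand of size at least `τ ^ (-q)` on every small box of size `τ` has infinite prior
integral as soon as `q` exceeds the order of the prior mass of the boxes. -/
theorem setLIntegral_eq_top_of_le_mixBox (hKstar : 1 ≤ Kstar) (hKlt : Kstar ≤ n)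
    (hastar_pos : ∀ k < Kstar, 0 < astar k)
    (hastar_sum : ∑ k ∈ Finset.range Kstar, astar k = 1) (hWb : IsCompact Wb)
    (hbstar : ∀ k < Kstar, bstar k ∈ interior Wb) (hr0 : 0 < r)
    (hr : Metric.closedBall (bstar 0) r ⊆ Wb) (hβ : 0 < β) (hα : ∀ i, 0 ≤ α i)
    (hα_pos : ∀ i : Fin n, Kstar ≤ i + 1 → 0 < α i) (hη : 0 < η)
    (hψ_cont : ContinuousOn ψ (Set.univ.pi fun _ => Wb))
    (hψ_pos : ∀ b ∈ Set.univ.pi fun _ => Wb, 0 < ψ b)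
    {G : (Fin n → ℝ) × (Fin (n + 1) → EuclideanSpace ℝ (Fin d)) → ℝ} {c q τ₁ : ℝ}
    (hc : 0 < c) (hτ₁ : 0 < τ₁)
    (hG : ∀ τ, 0 < τ → τ < τ₁ → ∀ w ∈ mixBox Kstar astar bstar α v β r τ, c * τ ^ (-q) ≤ G w)
    (hq : (n + 1 - Kstar : ℝ) * η + (Kstar - 1) + Kstar * d < q) :
    ∫⁻ w in mixDomain n Wb, ENNReal.ofReal (G w * mixPrior η ψ w) = ⊤ := by
  obtain ⟨M, -, τ₀, hτ₀, hbox⟩ := exists_mixBox_bounds (v := v) hKstar hKlt hastar_pos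
    hastar_sum hbstar hr hβ hα
  obtain ⟨c', hc', τ₂, hτ₂, hprior⟩ := exists_le_mixPrior_mixBox (v := v) hKstar hKlt hastar_pos
    hastar_sum hWb hbstar hr hβ hα hα_pos hη hψ_cont hψ_pos
  obtain ⟨c'', hc'', hvol⟩ := exists_le_volume_mixBox (Kstar := Kstar) (astar := astar)
    (bstar := bstar) (α := α) (v := v) hKlt hβ hr0
  set θ := q - ((n + 1 - Kstar : ℝ) * η + (Kstar - 1) + Kstar * d) with hθ
  have hθ0 : 0 < θ := by linarith
  have hlow : ∀ᶠ τ in nhdsWithin (0 : ℝ) (Set.Ioi 0), ENNReal.ofReal (c * c' * c'' * τ ^ (-θ)) ≤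
      ∫⁻ w in mixDomain n Wb, ENNReal.ofReal (G w * mixPrior η ψ w) := by
    filter_upwards [Ioo_mem_nhdsGT (lt_min hτ₀ (lt_min hτ₁ hτ₂))] with τ hτ
    obtain ⟨hτ0, hτmin⟩ := hτ
    obtain ⟨h1, h2, h3⟩ : τ < τ₀ ∧ τ < τ₁ ∧ τ < τ₂ := by simpa using hτmin
    have hsub : mixBox Kstar astar bstar α v β r τ ⊆ mixDomain n Wb := fun w hw =>
      (hbox τ hτ0 h1 w hw).1
    calc ENNReal.ofReal (c * c' * c'' * τ ^ (-θ))
        = ENNReal.ofReal (c * τ ^ (-q) * (c' * τ ^ ((n + 1 - Kstar : ℝ) * (η - 1)))) *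
          ENNReal.ofReal (c'' * τ ^ ((n : ℝ) + Kstar * d)) := by
          rw [← ENNReal.ofReal_mul (by positivity)]
          congr 1
          have : -θ = -q + ((n + 1 - Kstar : ℝ) * (η - 1)) + ((n : ℝ) + Kstar * d) := by
            rw [hθ]; ring
          rw [this, Real.rpow_add hτ0, Real.rpow_add hτ0]
          ring
      _ ≤ ENNReal.ofReal (c * τ ^ (-q) * (c' * τ ^ ((n + 1 - Kstar : ℝ) * (η - 1)))) *
          volume (mixBox Kstar astar bstar α v β r τ) := by gcongr; exact hvol τ hτ0
      _ = ∫⁻ _ in mixBox Kstar astar bstar α v β r τ,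
          ENNReal.ofReal (c * τ ^ (-q) * (c' * τ ^ ((n + 1 - Kstar : ℝ) * (η - 1)))) := by
          rw [setLIntegral_const]
      _ ≤ ∫⁻ w in mixBox Kstar astar bstar α v β r τ, ENNReal.ofReal (G w * mixPrior η ψ w) := by
          refine setLIntegral_mono' (measurableSet_mixBox τ) fun w hw => ?_
          refine ENNReal.ofReal_le_ofReal (mul_le_mul (hG τ hτ0 h2 w hw)
            (hprior τ hτ0 h3 w hw) (by positivity) ?_)
          exact (hG τ hτ0 h2 w hw).trans' (by positivity)
      _ ≤ _ := lintegral_mono_set hsub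
  have htend : Filter.Tendsto (fun τ : ℝ => ENNReal.ofReal (c * c' * c'' * τ ^ (-θ)))
      (nhdsWithin 0 (Set.Ioi 0)) (nhds ⊤) := by
    refine ENNReal.tendsto_ofReal_atTop.comp ?_
    refine Filter.Tendsto.const_mul_atTop (by positivity) ?_
    exact tendsto_rpow_neg_nhdsGT_zero (neg_neg_of_pos hθ0)
  exact top_le_iff.1 (le_of_tendsto htend hlow)

end Divergence

theorem setLIntegral_univ_pi_prod {α : Type*} [MeasureSpace α]
    [SigmaFinite (volume : Measure α)] {n : ℕ} (g : Fin n → α → ENNReal)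
    (hg : ∀ i, Measurable (g i)) {S : Fin n → Set α} (hS : ∀ i, MeasurableSet (S i)) :
    ∫⁻ x in Set.univ.pi S, ∏ i, g i (x i) = ∏ i, ∫⁻ y in S i, g i y := by
  rw [← lintegral_indicator (MeasurableSet.univ_pi hS)]
  simp_rw [← lintegral_indicator (hS _)]
  rw [← lintegral_fin_prod_eq_prod _ fun i => (hg i).indicator (hS i)]
  refine lintegral_congr fun x => ?_
  by_cases hx : x ∈ Set.univ.pi S
  · rw [Set.indicator_of_mem hx]
    exact Finset.prod_congr rfl fun i _ => (Set.indicator_of_mem (hx i (Set.mem_univ i)) _).symm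
  · rw [Set.indicator_of_notMem hx]
    obtain ⟨i, hi⟩ : ∃ i, x i ∉ S i := by simpa using hx
    exact (Finset.prod_eq_zero (Finset.mem_univ i) (Set.indicator_of_notMem hi _)).symm

theorem ENNReal.ofReal_rpow_neg_le_of_mul_le {c x H σ : ℝ} (hc : 0 < c) (hσ : 0 ≤ σ)
    (hH : 0 < H) (h : c * x ≤ H) :
    ENNReal.ofReal (H ^ (-σ)) ≤ ENNReal.ofReal (c ^ (-σ)) * ENNReal.ofReal x ^ (-σ) := by
  rw [← ENNReal.ofReal_rpow_of_pos hH, ← ENNReal.ofReal_rpow_of_pos hc,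
    ← ENNReal.mul_rpow_of_ne_top ENNReal.ofReal_ne_top ENNReal.ofReal_ne_top,
    ← ENNReal.ofReal_mul hc.le, ENNReal.rpow_neg, ENNReal.rpow_neg]
  exact ENNReal.inv_le_inv.2 (ENNReal.rpow_le_rpow (ENNReal.ofReal_le_ofReal h) hσ)

theorem ENNReal.ofReal_rpow_neg_half_le_of_mul_sq_le {c x H σ : ℝ} (hc : 0 < c) (hx : 0 ≤ x)
    (hσ : 0 ≤ σ) (hH : 0 < H) (h : c * x ^ 2 ≤ H) :
    ENNReal.ofReal (H ^ (-(σ / 2))) ≤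
      ENNReal.ofReal (c ^ (-(σ / 2))) * ENNReal.ofReal x ^ (-σ) := by
  refine (ENNReal.ofReal_rpow_neg_le_of_mul_le hc (by positivity) hH h).trans_eq ?_
  rw [ENNReal.ofReal_pow hx, ← ENNReal.rpow_natCast, ← ENNReal.rpow_mul]
  congr 2
  push_cast
  ring

/-- A continuous function on a compact set that is positive away from a point and quadratically
bounded below near that point is quadratically bounded below everywhere. -/
theorem exists_mul_sq_norm_sub_le_of_isCompact {E : Type*} [NormedAddCommGroup E] {S : Set E}
    (hS : IsCompact S) {g : E → ℝ} (hg : ContinuousOn g S) {b₀ : E}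
    (hpos : ∀ b ∈ S, b ≠ b₀ → 0 < g b) {ε c : ℝ} (hε : 0 < ε) (hc : 0 < c)
    (hquad : ∀ b ∈ S, ‖b - b₀‖ ≤ ε → c * ‖b - b₀‖ ^ 2 ≤ g b) :
    ∃ c' > 0, ∀ b ∈ S, c' * ‖b - b₀‖ ^ 2 ≤ g b := by
  set T := S ∩ {b | ε ≤ ‖b - b₀‖} with hT
  have hTc : IsCompact T :=
    hS.inter_right (isClosed_le continuous_const (by fun_prop))
  obtain ⟨D, hD⟩ := hS.isBounded.exists_norm_le
  obtain ⟨m, hm0, hm⟩ : ∃ m > 0, ∀ b ∈ T, m ≤ g b := by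
    rcases T.eq_empty_or_nonempty with h | h
    · exact ⟨1, one_pos, by simp [h]⟩
    · obtain ⟨b, hb, hmin⟩ := hTc.exists_isMinOn h (hg.mono Set.inter_subset_left)
      refine ⟨g b, hpos b hb.1 ?_, fun b' hb' => hmin hb'⟩
      rintro rfl
      have : ε ≤ ‖b - b‖ := hb.2
      simp at this
      linarith
  set Q := (|D| + ‖b₀‖) ^ 2 + 1 with hQ
  have hQ0 : 0 < Q := by positivity
  refine ⟨min c (m / Q), by positivity, fun b hb => ?_⟩
  rcases le_total ‖b - b₀‖ ε with h | h
  · exact (mul_le_mul_of_nonneg_right (min_le_left _ _) (by positivity)).trans (hquad b hb h)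
  · have h1 : ‖b - b₀‖ ^ 2 ≤ Q := by
      have h2 : ‖b - b₀‖ ≤ |D| + ‖b₀‖ :=
        (norm_sub_le _ _).trans (by gcongr; exact (hD b hb).trans (le_abs_self D))
      rw [hQ]
      nlinarith [norm_nonneg (b - b₀)]
    calc min c (m / Q) * ‖b - b₀‖ ^ 2 ≤ m / Q * Q := by
          gcongr
          exact min_le_right _ _
      _ = m := by field_simp
      _ ≤ g b := hm b ⟨hb, h⟩

theorem sum_range_ite_lt (x y : ℝ) {k m : ℕ} (hk : k ≤ m) :
    ∑ i ∈ Finset.range m, (if i < k then x else y) = k * x + (m - k) * y := by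
  obtain ⟨l, rfl⟩ := Nat.exists_eq_add_of_le hk
  rw [Finset.sum_range_add, Finset.sum_congr rfl fun i hi => if_pos (Finset.mem_range.1 hi)]
  simp

section Convergence

variable {d n : ℕ} {Kstar : ℕ} {astar : ℕ → ℝ} {bstar : ℕ → EuclideanSpace ℝ (Fin d)}
  {η : ℝ} {Wb : Set (EuclideanSpace ℝ (Fin d))}
  {ψ : (Fin (n + 1) → EuclideanSpace ℝ (Fin d)) → ℝ}
  {KLf : ℕ → EuclideanSpace ℝ (Fin d) → ℝ}

/-- The complete-data divergence as a sum of nonnegative terms. -/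
theorem mixHXY_eq_sum (hKlt : Kstar ≤ n)
    (hastar_sum : ∑ k ∈ Finset.range Kstar, astar k = 1)
    (w : (Fin n → ℝ) × (Fin (n + 1) → EuclideanSpace ℝ (Fin d))) :
    mixHXY Kstar astar KLf w =
      ∑ k ∈ Finset.range Kstar, (astar k * Real.log (astar k / mixWeights w.1 k) +
        mixWeights w.1 k - astar k) + ∑ k ∈ Finset.Ico Kstar (n + 1), mixWeights w.1 k +
      ∑ k ∈ Finset.range Kstar, astar k * KLf k (natIdx w.2 k) := by
  have h := sum_mixWeights w.1
  rw [← Finset.sum_range_add_sum_Ico _ (show Kstar ≤ n + 1 by omega)] at h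
  simp only [mixHXY, mul_add, Finset.sum_add_distrib, Finset.sum_sub_distrib]
  linarith

theorem le_mixHXY (hKlt : Kstar ≤ n) (hastar_pos : ∀ k < Kstar, 0 < astar k)
    (hastar_sum : ∑ k ∈ Finset.range Kstar, astar k = 1)
    (hKL : ∀ k < Kstar, ∀ b ∈ Wb, 0 ≤ KLf k b)
    {w : (Fin n → ℝ) × (Fin (n + 1) → EuclideanSpace ℝ (Fin d))} (hw : w ∈ mixDomain n Wb)
    (hpos : ∀ k < Kstar, 0 < mixWeights w.1 k) :
    (∀ k < Kstar, 1 / 4 * |mixWeights w.1 k - astar k| ^ 2 ≤ mixHXY Kstar astar KLf w) ∧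
    (∀ k, Kstar ≤ k → k < n + 1 → mixWeights w.1 k ≤ mixHXY Kstar astar KLf w) ∧
    (∀ k < Kstar, astar k * KLf k (natIdx w.2 k) ≤ mixHXY Kstar astar KLf w) := by
  have hb : ∀ k < Kstar, natIdx w.2 k ∈ Wb := fun k hk => by
    rw [natIdx_of_lt w.2 (by omega : k < n + 1)]
    exact hw.2 _ (Set.mem_univ _)
  have ha1 : ∀ k < Kstar, astar k ≤ 1 := fun k hk => by
    rw [← hastar_sum]
    exact Finset.single_le_sum (fun k hk => (hastar_pos k (Finset.mem_range.1 hk)).le)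
      (Finset.mem_range.2 hk)
  have hsq : ∀ k < Kstar, 1 / 4 * |mixWeights w.1 k - astar k| ^ 2 ≤
      astar k * Real.log (astar k / mixWeights w.1 k) + mixWeights w.1 k - astar k :=
    fun k hk => by
      have := sq_sub_div_four_le_mul_log_div (hastar_pos k hk).le (ha1 k hk) (hpos k hk)
        (mixWeights_le_one hw.1 (by omega))
      rw [sq_abs]
      linarith
  have h1 : ∀ k ∈ Finset.range Kstar, 0 ≤ astar k * Real.log (astar k / mixWeights w.1 k) +
      mixWeights w.1 k - astar k := fun k hk =>
    (by positivity : (0 : ℝ) ≤ 1 / 4 * |mixWeights w.1 k - astar k| ^ 2).trans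
      (hsq k (Finset.mem_range.1 hk))
  have h2 : ∀ k ∈ Finset.Ico Kstar (n + 1), 0 ≤ mixWeights w.1 k := fun k _ =>
    mixWeights_nonneg hw.1 k
  have h3 : ∀ k ∈ Finset.range Kstar, 0 ≤ astar k * KLf k (natIdx w.2 k) := fun k hk =>
    mul_nonneg (hastar_pos k (Finset.mem_range.1 hk)).le
      (hKL k (Finset.mem_range.1 hk) _ (hb k (Finset.mem_range.1 hk)))
  have s1 := Finset.sum_nonneg h1
  have s2 := Finset.sum_nonneg h2
  have s3 := Finset.sum_nonneg h3
  rw [mixHXY_eq_sum hKlt hastar_sum]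
  refine ⟨fun k hk => ?_, fun k hk hkn => ?_, fun k hk => ?_⟩
  · have := (hsq k hk).trans (Finset.single_le_sum h1 (Finset.mem_range.2 hk))
    linarith
  · have := Finset.single_le_sum h2 (Finset.mem_Ico.2 ⟨hk, hkn⟩)
    linarith
  · have := Finset.single_le_sum h3 (Finset.mem_range.2 hk)
    linarith

theorem exists_mixPrior_le (hWb : IsCompact Wb) (hη : 0 < η)
    (hψ_cont : ContinuousOn ψ (Set.univ.pi fun _ => Wb)) :
    ∃ C > 0, ∀ w ∈ mixDomain n Wb,
      mixPrior η ψ w ≤ C * ((1 - ∑ i, w.1 i) ^ (η - 1) * ∏ i, w.1 i ^ (η - 1)) := by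
  obtain ⟨D, hD⟩ := (isCompact_univ_pi fun _ : Fin (n + 1) => hWb).exists_bound_of_continuousOn
    hψ_cont
  have hΓ : 0 < Real.Gamma ((n + 1 : ℝ) * η) / Real.Gamma η ^ (n + 1) :=
    div_pos (Real.Gamma_pos_of_pos (by positivity)) (pow_pos (Real.Gamma_pos_of_pos hη) _)
  refine ⟨Real.Gamma ((n + 1 : ℝ) * η) / Real.Gamma η ^ (n + 1) * (|D| + 1), by positivity,
    fun w hw => ?_⟩
  rw [mixPrior, prod_range_succ_eq_fin fun k => mixWeights w.1 k ^ (η - 1), mixWeights_zero]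
  simp_rw [mixWeights_succ]
  have h0 : 0 ≤ (1 - ∑ i, w.1 i) ^ (η - 1) * ∏ i, w.1 i ^ (η - 1) :=
    mul_nonneg (Real.rpow_nonneg (by linarith [hw.1.2]) _)
      (Finset.prod_nonneg fun i _ => Real.rpow_nonneg (hw.1.1 i) _)
  have h1 : ψ w.2 ≤ |D| + 1 := by
    have := hD w.2 hw.2
    have := le_abs_self (ψ w.2)
    have := le_abs_self D
    simp only [Real.norm_eq_abs] at *
    linarith
  calc _ ≤ Real.Gamma ((n + 1 : ℝ) * η) / Real.Gamma η ^ (n + 1) *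
        ((1 - ∑ i, w.1 i) ^ (η - 1) * ∏ i, w.1 i ^ (η - 1)) * (|D| + 1) :=
        mul_le_mul_of_nonneg_left h1 (mul_nonneg hΓ.le h0)
    _ = _ := by ring

end Convergence

theorem rpow_le_max_rpow {m M y r : ℝ} (hm : 0 < m) (hmy : m ≤ y) (hyM : y ≤ M) :
    y ^ r ≤ max (m ^ r) (M ^ r) := by
  rcases le_total 0 r with h | h
  · exact (Real.rpow_le_rpow (hm.le.trans hmy) hyM h).trans (le_max_right _ _)
  · exact (Real.rpow_le_rpow_of_nonpos hm hmy h).trans (le_max_left _ _)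

/-- Finiteness of the product integrals majorizing the complete-data zeta function. -/
theorem setLIntegral_mixDomain_prod_lt_top {d n : ℕ} {Wb : Set (EuclideanSpace ℝ (Fin d))}
    (hWb : MeasurableSet Wb) {g : Fin n → ℝ → ENNReal}
    {h : Fin (n + 1) → EuclideanSpace ℝ (Fin d) → ENNReal} (hg : ∀ i, Measurable (g i))
    (hh : ∀ k, Measurable (h k)) (hg_fin : ∀ i, ∫⁻ t in Set.Icc (0 : ℝ) 1, g i t < ⊤)
    (hh_fin : ∀ k, ∫⁻ b in Wb, h k b < ⊤) :
    ∫⁻ w in mixDomain n Wb, (∏ i, g i (w.1 i)) * ∏ k, h k (w.2 k) < ⊤ := by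
  have hsub : mixDomain n Wb ⊆
      (Set.univ.pi fun _ : Fin n => Set.Icc (0 : ℝ) 1) ×ˢ (Set.univ.pi fun _ => Wb) := by
    refine Set.prod_mono (fun u hu i _ => ⟨hu.1 i, ?_⟩) subset_rfl
    exact (Finset.single_le_sum (fun i _ => hu.1 i) (Finset.mem_univ i)).trans hu.2
  refine (lintegral_mono_set hsub).trans_lt ?_
  have hgm : Measurable fun u : Fin n → ℝ => ∏ i, g i (u i) :=
    Finset.measurable_fun_prod _ fun i _ => (hg i).comp (measurable_pi_apply i)
  have hhm : Measurable fun b : Fin (n + 1) → EuclideanSpace ℝ (Fin d) => ∏ k, h k (b k) :=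
    Finset.measurable_fun_prod _ fun k _ => (hh k).comp (measurable_pi_apply k)
  rw [Measure.volume_eq_prod, ← Measure.prod_restrict,
    lintegral_prod_mul hgm.aemeasurable hhm.aemeasurable,
    setLIntegral_univ_pi_prod g hg fun _ => measurableSet_Icc,
    setLIntegral_univ_pi_prod h hh fun _ => hWb]
  exact ENNReal.mul_lt_top (ENNReal.prod_lt_top fun i _ => hg_fin i)
    (ENNReal.prod_lt_top fun k _ => hh_fin k)

section Convergence

variable {d n : ℕ} {Kstar : ℕ} {astar : ℕ → ℝ} {bstar : ℕ → EuclideanSpace ℝ (Fin d)}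
  {η : ℝ} {Wb : Set (EuclideanSpace ℝ (Fin d))}
  {ψ : (Fin (n + 1) → EuclideanSpace ℝ (Fin d)) → ℝ}
  {KLf : ℕ → EuclideanSpace ℝ (Fin d) → ℝ}

theorem setLIntegral_mixHXY_rpow_neg_lt_top (hKstar : 1 ≤ Kstar) (hKlt : Kstar ≤ n)
    (hastar_pos : ∀ k < Kstar, 0 < astar k)
    (hastar_sum : ∑ k ∈ Finset.range Kstar, astar k = 1) (hWb : IsCompact Wb) {c : ℝ}
    (hc : 0 < c) (hKL : ∀ k < Kstar, ∀ b ∈ Wb, c * ‖b - bstar k‖ ^ 2 ≤ KLf k b) (hη : 0 < η)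
    (hψ_cont : ContinuousOn ψ (Set.univ.pi fun _ => Wb))
    {s : ℝ} (hs : 0 < s)
    (hs' : s < (n + 1 - Kstar : ℝ) * η + (Kstar - 1) / 2 + Kstar * d / 2) :
    ∫⁻ w in mixDomain n Wb, ENNReal.ofReal
        ((if (∀ k < Kstar, 0 < mixWeights w.1 k) ∧ mixHXY Kstar astar KLf w ≠ 0 then
            mixHXY Kstar astar KLf w ^ (-s) else 0) * mixPrior η ψ w) < ⊤ := by
  set l := (n + 1 - Kstar : ℝ) * η + (Kstar - 1) / 2 + Kstar * d / 2 with hl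
  have hl0 : 0 < l := hs.trans hs'
  set ρ := s / l with hρ
  have hρ0 : 0 < ρ := div_pos hs hl0
  have hρ1 : ρ < 1 := (div_lt_one hl0).2 hs'
  obtain ⟨C, hC, hprior⟩ := exists_mixPrior_le (n := n) hWb hη hψ_cont
  have hKL0 : ∀ k < Kstar, ∀ b ∈ Wb, 0 ≤ KLf k b := fun k hk b hb =>
    (hKL k hk b hb).trans' (by positivity)
  set H := mixHXY Kstar astar KLf (n := n) with hHdef
  have hH := fun w hw hpos =>
    le_mixHXY (n := n) (w := w) hKlt hastar_pos hastar_sum hKL0 hw hpos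
  -- exponents
  set σ : Fin n → ℝ := fun i => if (i : ℕ) + 1 < Kstar then ρ / 2 else ρ * η with hσ
  set τ : Fin (n + 1) → ℝ := fun k => if (k : ℕ) < Kstar then ρ * d / 2 else 0 with hτ
  have hsum : s = ∑ i, σ i + ∑ k, τ k := by
    have h1 : ∑ i, σ i = (Kstar - 1) * (ρ / 2) + (n + 1 - Kstar) * (ρ * η) := by
      have h2 := sum_range_ite_lt (ρ / 2) (ρ * η) (show Kstar - 1 ≤ n by omega)
      rw [Finset.sum_range] at h2
      rw [Nat.cast_sub hKstar] at h2
      push_cast at h2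
      rw [show (n + 1 - Kstar : ℝ) = n - (Kstar - 1) by ring, ← h2]
      refine Finset.sum_congr rfl fun i _ => ?_
      simp only [hσ]
      congr 1
      simp only [eq_iff_iff]
      omega
    have h3 : ∑ k, τ k = Kstar * (ρ * d / 2) := by
      have h4 := sum_range_ite_lt (ρ * d / 2) 0 (show Kstar ≤ n + 1 by omega)
      rw [Finset.sum_range, mul_zero, add_zero] at h4
      exact h4
    rw [h1, h3]
    have : s = ρ * l := by rw [hρ]; field_simp
    rw [this, hl]
    ring
  -- majorants
  set g : Fin n → ℝ → ENNReal := fun i t => if (i : ℕ) + 1 < Kstar then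
    ENNReal.ofReal ‖t - astar (i + 1)‖ ^ (-ρ) else
    ENNReal.ofReal (t ^ (η - 1)) * ENNReal.ofReal t ^ (-(ρ * η)) with hg
  set h : Fin (n + 1) → EuclideanSpace ℝ (Fin d) → ENNReal := fun k b => if (k : ℕ) < Kstar then
    ENNReal.ofReal ‖b - bstar k‖ ^ (-(ρ * d)) else 1 with hh
  have hgm : ∀ i, Measurable (g i) := fun i => by
    simp only [hg]
    split_ifs <;> fun_prop
  have hhm : ∀ k, Measurable (h k) := fun k => by
    simp only [hh]
    split_ifs <;> fun_prop
  have hg_fin : ∀ i, ∫⁻ t in Set.Icc (0 : ℝ) 1, g i t < ⊤ := fun i => by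
    simp only [hg]
    split_ifs
    · exact setLIntegral_norm_sub_rpow_neg_lt_top volume hρ0.le (Or.inr (by simpa using hρ1)) _
        (Metric.isBounded_Icc 0 1)
    · rw [setLIntegral_congr Ioc_ae_eq_Icc.symm]
      refine lt_of_eq_of_lt ?_ (setLIntegral_Icc_rpow_lt_top
        (show -1 < η - 1 - ρ * η by nlinarith))
      rw [← setLIntegral_congr Ioc_ae_eq_Icc]
      refine setLIntegral_congr_fun measurableSet_Ioc fun t ht => ?_
      rw [ENNReal.ofReal_rpow_of_pos ht.1, ← ENNReal.ofReal_mul (Real.rpow_nonneg ht.1.le _),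
        ← Real.rpow_add ht.1]
      rfl
  have hh_fin : ∀ k, ∫⁻ b in Wb, h k b < ⊤ := fun k => by
    simp only [hh]
    split_ifs
    · refine setLIntegral_norm_sub_rpow_neg_lt_top volume (by positivity) ?_ _ hWb.isBounded
      rcases Nat.eq_zero_or_pos d with hd | hd
      · left
        simp [hd]
      · right
        have : (0 : ℝ) < d := by exact_mod_cast hd
        simp only [finrank_euclideanSpace, Fintype.card_fin]
        nlinarith
    · simpa using hWb.measure_lt_top
  have hb_mem : ∀ w ∈ mixDomain n Wb, ∀ k, w.2 k ∈ Wb := fun w hw k => hw.2 k (Set.mem_univ k)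
  have hfac_g : ∀ i : Fin n, ∃ D : ENNReal, D ≠ ⊤ ∧ ∀ w ∈ mixDomain n Wb,
      (∀ k < Kstar, astar k / 2 ≤ mixWeights w.1 k) → (∀ k < Kstar, 0 < mixWeights w.1 k) →
      0 < H w → ENNReal.ofReal (H w ^ (-σ i)) * ENNReal.ofReal (w.1 i ^ (η - 1)) ≤
        D * g i (w.1 i) := by
    intro i
    by_cases hi : (i : ℕ) + 1 < Kstar
    · refine ⟨ENNReal.ofReal ((1 / 4 : ℝ) ^ (-(ρ / 2))) * ENNReal.ofReal
        (max ((astar (i + 1) / 2) ^ (η - 1)) (1 ^ (η - 1))),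
        ENNReal.mul_ne_top ENNReal.ofReal_ne_top ENNReal.ofReal_ne_top,
        fun w hw hA hpos hHw => ?_⟩
      have ha := hastar_pos _ hi
      have h1 := (hH w hw hpos).1 _ hi
      have h2 := hA _ hi
      have h3 := mixWeights_le_one hw.1 (k := i + 1) (by omega)
      rw [mixWeights_succ] at h1 h2 h3
      simp only [hσ, hg, if_pos hi]
      rw [mul_right_comm]
      exact mul_le_mul'
        (ENNReal.ofReal_rpow_neg_half_le_of_mul_sq_le (by norm_num) (abs_nonneg _) hρ0.le hHw h1)
        (ENNReal.ofReal_le_ofReal (rpow_le_max_rpow (by positivity) h2 h3))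
    · refine ⟨1, ENNReal.one_ne_top, fun w hw hA hpos hHw => ?_⟩
      have h1 := (hH w hw hpos).2.1 (i + 1) (by omega) (by omega)
      rw [mixWeights_succ, ← one_mul (w.1 i)] at h1
      have h2 := ENNReal.ofReal_rpow_neg_le_of_mul_le one_pos (σ := ρ * η) (by positivity) hHw h1
      simp only [hσ, hg, if_neg hi, one_mul]
      rw [mul_comm]
      refine mul_le_mul_right (h2.trans_eq ?_) _
      simp
  have hfac_h : ∀ k : Fin (n + 1), ∃ D : ENNReal, D ≠ ⊤ ∧ ∀ w ∈ mixDomain n Wb,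
      (∀ k < Kstar, 0 < mixWeights w.1 k) → 0 < H w →
        ENNReal.ofReal (H w ^ (-τ k)) ≤ D * h k (w.2 k) := by
    intro k
    by_cases hk : (k : ℕ) < Kstar
    · refine ⟨ENNReal.ofReal ((astar k * c) ^ (-(ρ * d / 2))), ENNReal.ofReal_ne_top,
        fun w hw hpos hHw => ?_⟩
      have ha := hastar_pos _ hk
      have h1 := (hH w hw hpos).2.2 _ hk
      have h2 := hKL k hk (w.2 k) (hb_mem w hw k)
      rw [natIdx_of_lt w.2 k.2] at h1
      simp only [hτ, hh, if_pos hk]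
      refine ENNReal.ofReal_rpow_neg_half_le_of_mul_sq_le (by positivity) (norm_nonneg _)
        (by positivity) hHw (le_trans ?_ h1)
      rw [mul_assoc]
      exact mul_le_mul_of_nonneg_left h2 ha.le
    · refine ⟨1, ENNReal.one_ne_top, fun w hw hpos hHw => ?_⟩
      simp [hτ, hh, if_neg hk]
  choose Dg hDg_top hDg using hfac_g
  choose Dh hDh_top hDh using hfac_h
  set D₀ := max ((astar 0 / 2) ^ (η - 1)) (1 ^ (η - 1)) with hD₀
  -- far from the true weights the divergence is bounded below
  obtain ⟨m, hm0, hm⟩ : ∃ m > 0, ∀ k < Kstar, m ≤ (astar k / 4) ^ 2 := by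
    have hne : (Finset.range Kstar).Nonempty := ⟨0, Finset.mem_range.2 (by omega)⟩
    refine ⟨(Finset.range Kstar).inf' hne fun k => (astar k / 4) ^ 2, ?_, fun k hk =>
      Finset.inf'_le (fun k => (astar k / 4) ^ 2) (Finset.mem_range.2 hk)⟩
    refine (Finset.lt_inf'_iff _).2 fun k hk => ?_
    have := hastar_pos k (Finset.mem_range.1 hk)
    positivity
  set CA : ENNReal := ENNReal.ofReal C * ENNReal.ofReal D₀ * (∏ i, Dg i) * ∏ k, Dh k with hCA
  have hCA_top : CA ≠ ⊤ := ENNReal.mul_ne_top (ENNReal.mul_ne_top (ENNReal.mul_ne_top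
    ENNReal.ofReal_ne_top ENNReal.ofReal_ne_top) (ENNReal.prod_ne_top fun i _ => hDg_top i))
    (ENNReal.prod_ne_top fun k _ => hDh_top k)
  set CB : ENNReal := ENNReal.ofReal (m ^ (-s) * C) with hCB
  set A : (Fin n → ℝ) × (Fin (n + 1) → EuclideanSpace ℝ (Fin d)) → ENNReal := fun w =>
    (∏ i, g i (w.1 i)) * ∏ k, h k (w.2 k) with hA
  set B : (Fin n → ℝ) → ENNReal := fun u =>
    ENNReal.ofReal ((1 - ∑ i, u i) ^ (η - 1)) * ∏ i, ENNReal.ofReal (u i ^ (η - 1)) with hB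
  have hBm : Measurable B := by fun_prop
  have hAm : Measurable A := by
    refine Measurable.mul ?_ ?_
    · exact Finset.measurable_fun_prod _ fun i _ =>
        (hgm i).comp ((measurable_pi_apply i).comp measurable_fst)
    · exact Finset.measurable_fun_prod _ fun k _ =>
        (hhm k).comp ((measurable_pi_apply k).comp measurable_snd)
  have hdir : ∀ w ∈ mixDomain n Wb, ENNReal.ofReal
      (C * ((1 - ∑ i, w.1 i) ^ (η - 1) * ∏ i, w.1 i ^ (η - 1))) = ENNReal.ofReal C * B w.1 := by
    intro w hw
    rw [ENNReal.ofReal_mul hC.le, ENNReal.ofReal_mul (Real.rpow_nonneg (by linarith [hw.1.2]) _),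
      ENNReal.ofReal_prod_of_nonneg fun i _ => Real.rpow_nonneg (hw.1.1 i) _]
  have hbound : ∀ w ∈ mixDomain n Wb, ENNReal.ofReal
      ((if (∀ k < Kstar, 0 < mixWeights w.1 k) ∧ H w ≠ 0 then H w ^ (-s) else 0) *
        mixPrior η ψ w) ≤ CA * A w + CB * (B w.1 * 1) := by
    intro w hw
    split_ifs with hcond
    swap
    · simp
    obtain ⟨hpos, hne⟩ := hcond
    have hHpos : 0 < H w := lt_of_le_of_ne ((by positivity : (0 : ℝ) ≤ 1 / 4 *
      |mixWeights w.1 0 - astar 0| ^ 2).trans ((hH w hw hpos).1 0 hKstar)) hne.symm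
    have hps : 0 ≤ H w ^ (-s) := Real.rpow_nonneg hHpos.le _
    have hstep : ENNReal.ofReal (H w ^ (-s) * mixPrior η ψ w) ≤
        ENNReal.ofReal (H w ^ (-s)) * (ENNReal.ofReal C * B w.1) := by
      rw [← hdir w hw, ← ENNReal.ofReal_mul hps]
      exact ENNReal.ofReal_le_ofReal (mul_le_mul_of_nonneg_left (hprior w hw) hps)
    by_cases hnear : ∀ k < Kstar, astar k / 2 ≤ mixWeights w.1 k
    · refine le_trans (hstep.trans ?_) le_self_add
      have h0 : ENNReal.ofReal ((1 - ∑ i, w.1 i) ^ (η - 1)) ≤ ENNReal.ofReal D₀ := by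
        have ha := hastar_pos 0 hKstar
        rw [← mixWeights_zero]
        exact ENNReal.ofReal_le_ofReal (rpow_le_max_rpow (by positivity) (hnear 0 hKstar)
          (mixWeights_le_one hw.1 (by omega)))
      have hsplit : ENNReal.ofReal (H w ^ (-s)) =
          (∏ i, ENNReal.ofReal (H w ^ (-σ i))) * ∏ k, ENNReal.ofReal (H w ^ (-τ k)) := by
        rw [hsum, neg_add, Real.rpow_add hHpos, ← Finset.sum_neg_distrib,
          ← Finset.sum_neg_distrib, Real.rpow_sum_of_pos hHpos, Real.rpow_sum_of_pos hHpos,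
          ENNReal.ofReal_mul (Finset.prod_nonneg fun i _ => Real.rpow_nonneg hHpos.le _),
          ENNReal.ofReal_prod_of_nonneg fun i _ => Real.rpow_nonneg hHpos.le _,
          ENNReal.ofReal_prod_of_nonneg fun i _ => Real.rpow_nonneg hHpos.le _]
      calc ENNReal.ofReal (H w ^ (-s)) * (ENNReal.ofReal C * B w.1)
          = ENNReal.ofReal C * ENNReal.ofReal ((1 - ∑ i, w.1 i) ^ (η - 1)) *
            (∏ i, ENNReal.ofReal (H w ^ (-σ i)) * ENNReal.ofReal (w.1 i ^ (η - 1))) *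
            ∏ k, ENNReal.ofReal (H w ^ (-τ k)) := by
            rw [hsplit, hB, Finset.prod_mul_distrib]
            ring
        _ ≤ ENNReal.ofReal C * ENNReal.ofReal D₀ * (∏ i, Dg i * g i (w.1 i)) *
            ∏ k, Dh k * h k (w.2 k) := by
            refine mul_le_mul' (mul_le_mul' (mul_le_mul' le_rfl h0) ?_) ?_
            · exact Finset.prod_le_prod' fun i _ => hDg i w hw hnear hpos hHpos
            · exact Finset.prod_le_prod' fun k _ => hDh k w hw hpos hHpos
        _ = CA * A w := by
            rw [hCA, hA, Finset.prod_mul_distrib, Finset.prod_mul_distrib]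
            ring
    · refine le_trans (hstep.trans ?_) le_add_self
      push Not at hnear
      obtain ⟨k, hk, hlt⟩ := hnear
      have hmH : m ≤ H w := by
        refine (hm k hk).trans (le_trans ?_ ((hH w hw hpos).1 k hk))
        have ha := hastar_pos k hk
        rw [sq_abs]
        nlinarith
      rw [mul_one, hCB, ENNReal.ofReal_mul (by positivity), mul_assoc]
      refine mul_le_mul_left (ENNReal.ofReal_le_ofReal ?_) _
      exact Real.rpow_le_rpow_of_nonpos hm0 hmH (by linarith)
  refine (setLIntegral_mono' (measurableSet_mixDomain hWb.measurableSet) hbound).trans_lt ?_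
  rw [lintegral_add_left (hAm.const_mul _), lintegral_const_mul _ hAm, lintegral_const_mul']
  · refine ENNReal.add_lt_top.2 ⟨ENNReal.mul_lt_top hCA_top.lt_top ?_,
      ENNReal.mul_lt_top ENNReal.ofReal_lt_top ?_⟩
    · exact setLIntegral_mixDomain_prod_lt_top hWb.measurableSet hgm hhm hg_fin hh_fin
    · rw [mixDomain, Measure.volume_eq_prod, ← Measure.prod_restrict,
        lintegral_prod_mul hBm.aemeasurable aemeasurable_const]
      refine ENNReal.mul_lt_top (setLIntegral_dirichlet_lt_top hη) ?_
      rw [setLIntegral_one]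
      exact (isCompact_univ_pi fun _ => hWb).measure_lt_top
  · exact ENNReal.ofReal_ne_top

end Convergence

section Threshold

variable {d n : ℕ} {Kstar : ℕ} {astar : ℕ → ℝ} {bstar : ℕ → EuclideanSpace ℝ (Fin d)}
  {η : ℝ} {Wb : Set (EuclideanSpace ℝ (Fin d))}
  {ψ : (Fin (n + 1) → EuclideanSpace ℝ (Fin d)) → ℝ}
  {KLf : ℕ → EuclideanSpace ℝ (Fin d) → ℝ}

theorem setLIntegral_mixHXY_rpow_neg_eq_top (hKstar : 1 ≤ Kstar) (hKlt : Kstar ≤ n)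
    (hastar_pos : ∀ k < Kstar, 0 < astar k)
    (hastar_sum : ∑ k ∈ Finset.range Kstar, astar k = 1) (hWb : IsCompact Wb)
    (hbstar : ∀ k < Kstar, bstar k ∈ interior Wb)
    (hKL : ∀ k < Kstar, ∀ b ∈ Wb, 0 ≤ KLf k b) {ε₀ C₀ : ℝ} (hε₀ : 0 < ε₀) (hC₀ : 0 < C₀)
    (hquad : ∀ k < Kstar, ∀ b ∈ Wb, ‖b - bstar k‖ ≤ ε₀ → KLf k b ≤ C₀ * ‖b - bstar k‖ ^ 2)
    (hη : 0 < η) (hψ_cont : ContinuousOn ψ (Set.univ.pi fun _ => Wb))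
    (hψ_pos : ∀ b ∈ Set.univ.pi fun _ => Wb, 0 < ψ b) {s : ℝ} (hs : 0 < s)
    (hs' : (n + 1 - Kstar : ℝ) * η + (Kstar - 1) + Kstar * d < s) :
    ∫⁻ w in mixDomain n Wb, ENNReal.ofReal
        ((if (∀ k < Kstar, 0 < mixWeights w.1 k) ∧ mixHXY Kstar astar KLf w ≠ 0 then
            mixHXY Kstar astar KLf w ^ (-s) else 0) * mixPrior η ψ w) = ⊤ := by
  obtain ⟨r, hr0, hr⟩ : ∃ r > 0, Metric.closedBall (bstar 0) r ⊆ Wb :=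
    Metric.nhds_basis_closedBall.mem_iff.1 (mem_interior_iff_mem_nhds.1 (hbstar 0 hKstar))
  have hα : ∀ i : Fin n, 0 ≤ (fun _ => 1 : Fin n → ℝ) i := fun _ => zero_le_one
  obtain ⟨M, hM, τ₀, hτ₀, hbox⟩ := exists_mixBox_bounds (v := 0) (β := 1) hKstar hKlt
    hastar_pos hastar_sum hbstar hr one_pos hα
  set C := Kstar * (2 * M + C₀ * M * ε₀) with hC
  have hK0 : (0 : ℝ) < Kstar := by exact_mod_cast hKstar
  have hC0 : 0 < C := by positivity
  refine setLIntegral_eq_top_of_le_mixBox (α := fun _ => 1) (v := 0) (β := 1) (q := s)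
    (c := C ^ (-s)) (τ₁ := min τ₀ (ε₀ / M)) hKstar hKlt hastar_pos hastar_sum hWb hbstar hr0 hr
    one_pos hα (fun _ _ => one_pos) hη hψ_cont hψ_pos (by positivity) (by positivity)
    (fun τ hτ hτ' w hw => ?_) hs'
  obtain ⟨hdom, hhalf, ha, hb, -⟩ := hbox τ hτ (hτ'.trans_le (min_le_left _ _)) w hw
  have hMτ : M * τ ≤ ε₀ := by
    have := (hτ'.trans_le (min_le_right _ _)).le
    rwa [le_div_iff₀ hM, mul_comm] at this
  have hpos : ∀ k < Kstar, 0 < mixWeights w.1 k := fun k hk =>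
    (half_pos (hastar_pos k hk)).trans_le (hhalf k hk)
  have hHpos : 0 < mixHXY Kstar astar KLf w := by
    have h1 := (le_mixHXY hKlt hastar_pos hastar_sum hKL hdom hpos).2.1 Kstar le_rfl (by omega)
    refine lt_of_lt_of_le ?_ h1
    obtain ⟨i, hi⟩ : ∃ i : Fin n, Kstar = i + 1 := ⟨⟨Kstar - 1, by omega⟩, by simp only; omega⟩
    have h2 := (hw.1 i (Set.mem_univ i)).1
    rw [hi, mixWeights_succ]
    rw [trueWeights, if_neg (by omega)] at h2
    linarith
  have hHle : mixHXY Kstar astar KLf w ≤ C * τ := by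
    have hterm : ∀ k ∈ Finset.range Kstar, astar k * (Real.log (astar k / mixWeights w.1 k) +
        KLf k (natIdx w.2 k)) ≤ (2 * M + C₀ * M * ε₀) * τ := by
      intro k hk
      rw [Finset.mem_range] at hk
      have hak := hastar_pos k hk
      have hak1 : astar k ≤ 1 := by
        rw [← hastar_sum]
        exact Finset.single_le_sum (fun k hk => (hastar_pos k (Finset.mem_range.1 hk)).le)
          (Finset.mem_range.2 hk)
      have hlog : astar k * Real.log (astar k / mixWeights w.1 k) ≤ 2 * M * τ := by
        have h1 := Real.log_le_sub_one_of_pos (div_pos hak (hpos k hk))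
        have h2 : astar k / mixWeights w.1 k - 1 ≤ 2 * M * τ / astar k := by
          have h3 := (abs_le.1 (ha k hk)).1
          rw [div_sub_one (hpos k hk).ne', div_le_div_iff₀ (hpos k hk) hak]
          have h4 := hhalf k hk
          have h5 : 0 < M * τ := by positivity
          nlinarith
        calc _ ≤ astar k * (2 * M * τ / astar k) :=
              mul_le_mul_of_nonneg_left (h1.trans h2) hak.le
          _ = 2 * M * τ := by field_simp
      have hKLk : astar k * KLf k (natIdx w.2 k) ≤ C₀ * M * ε₀ * τ := by
        have hmem : natIdx w.2 k ∈ Wb := by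
          rw [natIdx_of_lt w.2 (by omega : k < n + 1)]
          exact hdom.2 _ (Set.mem_univ _)
        have h1 := hquad k hk _ hmem ((hb k hk).trans hMτ)
        have h2 : ‖natIdx w.2 k - bstar k‖ ^ 2 ≤ (M * τ) * ε₀ := by
          rw [sq]
          exact mul_le_mul (hb k hk) ((hb k hk).trans hMτ) (norm_nonneg _) (by positivity)
        calc astar k * KLf k (natIdx w.2 k) ≤ 1 * KLf k (natIdx w.2 k) :=
              mul_le_mul_of_nonneg_right hak1 (hKL k hk _ hmem)
          _ ≤ C₀ * ((M * τ) * ε₀) := by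
              rw [one_mul]
              exact h1.trans (mul_le_mul_of_nonneg_left h2 hC₀.le)
          _ = C₀ * M * ε₀ * τ := by ring
      rw [mul_add]
      linarith
    calc mixHXY Kstar astar KLf w ≤ ∑ _k ∈ Finset.range Kstar, (2 * M + C₀ * M * ε₀) * τ :=
          Finset.sum_le_sum hterm
      _ = C * τ := by
          rw [hC]
          simp
          ring
  rw [if_pos ⟨hpos, hHpos.ne'⟩, ← Real.mul_rpow hC0.le hτ.le]
  exact Real.rpow_le_rpow_of_nonpos hHpos hHle (by linarith)

/-- A threshold below which `I` is finite, and far above which it is infinite, bounds the supremum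
of the finiteness range from below. -/
theorem le_sSup_of_lt_top_of_eq_top {I : ℝ → ENNReal} {l u : ℝ} (hl : 0 < l)
    (hfin : ∀ s, 0 < s → s < l → I s < ⊤) (htop : ∀ s, 0 < s → u < s → I s = ⊤) :
    l ≤ sSup ({0} ∪ {s : ℝ | 0 < s ∧ I s < ⊤}) := by
  have hbdd : BddAbove ({0} ∪ {s : ℝ | 0 < s ∧ I s < ⊤}) := by
    refine ⟨max 0 u, ?_⟩
    rintro s (rfl | ⟨hs0, hs⟩)
    · exact le_max_left _ _
    · refine le_max_of_le_right (not_lt.1 fun h => ?_)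
      exact hs.ne (htop s hs0 h)
  refine le_of_forall_lt fun s hs => ?_
  obtain ⟨t, ht, htl⟩ := exists_between (max_lt hs hl)
  have ht0 : 0 < t := (le_max_right _ _).trans_lt ht
  exact ((le_max_left _ _).trans_lt ht).trans_le
    (le_csSup hbdd (Or.inr ⟨ht0, hfin t ht0 htl⟩))

theorem sSup_le_of_eq_top {I : ℝ → ENNReal} {l : ℝ} (hl : 0 ≤ l)
    (htop : ∀ s, 0 < s → l < s → I s = ⊤) :
    sSup ({0} ∪ {s : ℝ | 0 < s ∧ I s < ⊤}) ≤ l := by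
  refine csSup_le ⟨0, Or.inl rfl⟩ ?_
  rintro s (rfl | ⟨hs0, hs⟩)
  · exact hl
  · exact not_lt.1 fun h => hs.ne (htop s hs0 h)

end Threshold

theorem Finset.norm_sum_sub_single_le {ι V : Type*} [SeminormedAddCommGroup V]
    {s : Finset ι} {x : ι → V} {j : ι} (hj : j ∈ s) {B : ℝ} (hB : 0 ≤ B)
    (h : ∀ i ∈ s, i ≠ j → ‖x i‖ ≤ B) : ‖∑ i ∈ s, x i - x j‖ ≤ s.card * B := by
  classical
  rw [← Finset.sum_erase_eq_sub hj]
  refine (norm_sum_le_of_le _ fun i hi =>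
    h i (Finset.mem_of_mem_erase hi) (Finset.ne_of_mem_erase hi)).trans ?_
  rw [Finset.sum_const, nsmul_eq_mul]
  gcongr
  exact Finset.erase_subset _ _

section Mixture

variable {d n : ℕ} {Kstar : ℕ} {astar : ℕ → ℝ} {bstar : ℕ → EuclideanSpace ℝ (Fin d)}
  {Wb : Set (EuclideanSpace ℝ (Fin d))} {V : Type*} [NormedAddCommGroup V] [NormedSpace ℝ V]
  {F : EuclideanSpace ℝ (Fin d) → V}

/-- Splitting of a mixture error into displacements of the true components and changes of the
mixing weights. -/
theorem sum_smul_sub_sum_smul_eq (hKstar : 1 ≤ Kstar) (hKlt : Kstar ≤ n)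
    (hastar_sum : ∑ k ∈ Finset.range Kstar, astar k = 1)
    (w : (Fin n → ℝ) × (Fin (n + 1) → EuclideanSpace ℝ (Fin d))) :
    ∑ k ∈ Finset.range (n + 1), mixWeights w.1 k • F (natIdx w.2 k) -
      ∑ k ∈ Finset.range Kstar, astar k • F (bstar k) =
    ∑ k ∈ Finset.range Kstar, mixWeights w.1 k • (F (natIdx w.2 k) - F (bstar k)) +
    ∑ i : Fin n, (w.1 i - trueWeights Kstar astar i) •
      ((if (i : ℕ) + 1 < Kstar then F (bstar (i + 1)) else F (natIdx w.2 (i + 1))) -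
        F (bstar 0)) := by
  set G : ℕ → V := fun k => if k < Kstar then F (bstar k) else F (natIdx w.2 k) with hG
  have hfilter : ∀ x : ℕ → V, ∑ k ∈ Finset.range (n + 1), (if k < Kstar then x k else 0) =
      ∑ k ∈ Finset.range Kstar, x k := fun x => by
    rw [← Finset.sum_filter]
    refine Finset.sum_congr ?_ fun _ _ => rfl
    ext k
    simp only [Finset.mem_filter, Finset.mem_range]
    omega
  have h1 : ∑ k ∈ Finset.range (n + 1), mixWeights w.1 k • F (natIdx w.2 k) =
      ∑ k ∈ Finset.range (n + 1), mixWeights w.1 k • G k +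
      ∑ k ∈ Finset.range Kstar, mixWeights w.1 k • (F (natIdx w.2 k) - F (bstar k)) := by
    rw [← hfilter, ← Finset.sum_add_distrib]
    refine Finset.sum_congr rfl fun k _ => ?_
    simp only [hG]
    split_ifs
    · rw [smul_sub]; abel
    · rw [add_zero]
  have h2 : ∑ k ∈ Finset.range Kstar, astar k • F (bstar k) =
      ∑ k ∈ Finset.range (n + 1), (if k < Kstar then astar k else 0) • G k := by
    rw [← hfilter]
    refine Finset.sum_congr rfl fun k _ => ?_
    simp only [hG]
    split_ifs <;> simp
  have h3 : ∑ i : Fin n, (w.1 i - trueWeights Kstar astar i) • (G (i + 1) - F (bstar 0)) =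
      ∑ k ∈ Finset.range (n + 1), mixWeights w.1 k • G k -
      ∑ k ∈ Finset.range (n + 1), (if k < Kstar then astar k else 0) • G k := by
    have hG0 : G 0 = F (bstar 0) := if_pos hKstar
    rw [sum_range_succ_eq_fin fun k => mixWeights w.1 k • G k,
      sum_range_succ_eq_fin fun k => (if k < Kstar then astar k else 0) • G k, mixWeights_zero,
      hG0, if_pos (by omega : 0 < Kstar)]
    simp_rw [mixWeights_succ, smul_sub, sub_smul, Finset.sum_sub_distrib, ← Finset.sum_smul,
      sum_trueWeights hKstar hKlt hastar_sum, trueWeights]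
    module
  rw [h1, h2]
  simp only [hG] at h3 ⊢
  rw [h3]
  abel

variable {α : Fin n → ℝ} {v : ℕ → EuclideanSpace ℝ (Fin d)} {β r D L ε₁ : ℝ}

theorem exists_norm_mixture_sub_le_on_mixBox (hKstar : 1 ≤ Kstar) (hKlt : Kstar ≤ n)
    (hastar_pos : ∀ k < Kstar, 0 < astar k)
    (hastar_sum : ∑ k ∈ Finset.range Kstar, astar k = 1)
    (hbstar : ∀ k < Kstar, bstar k ∈ interior Wb)
    (hr : Metric.closedBall (bstar 0) r ⊆ Wb) (hβ : 0 < β) (hα : ∀ i, 0 ≤ α i)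
    (hD : ∀ b ∈ Wb, ‖F b‖ ≤ D) (hL : 0 < L) (hε₁ : 0 < ε₁)
    (hLip : ∀ k < Kstar, ∀ b ∈ Wb, ‖b - bstar k‖ ≤ ε₁ →
      ‖F b - F (bstar k)‖ ≤ L * ‖b - bstar k‖) :
    ∃ C > 0, ∃ τ₀ > 0, ∀ τ, 0 < τ → τ < τ₀ → ∀ w ∈ mixBox Kstar astar bstar α v β r τ,
      ‖∑ k ∈ Finset.range (n + 1), mixWeights w.1 k • F (natIdx w.2 k) -
        ∑ k ∈ Finset.range Kstar, astar k • F (bstar k)‖ ≤ C * τ := by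
  obtain ⟨M, hM, τ₀, hτ₀, hbox⟩ := exists_mixBox_bounds (v := v) hKstar hKlt
    hastar_pos hastar_sum hbstar hr hβ hα
  have hb0 : bstar 0 ∈ Wb := interior_subset (hbstar 0 hKstar)
  have hD0 : 0 ≤ D := (norm_nonneg _).trans (hD _ hb0)
  have hK0 : (0 : ℝ) < Kstar := by exact_mod_cast hKstar
  refine ⟨Kstar * (L * M) + n * (M * (2 * D)), by positivity, min τ₀ (ε₁ / M), by positivity,
    fun τ hτ hτ' w hw => ?_⟩
  obtain ⟨hdom, -, -, hb, hu⟩ := hbox τ hτ (hτ'.trans_le (min_le_left _ _)) w hw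
  have hMτ : M * τ ≤ ε₁ := by
    have := (hτ'.trans_le (min_le_right _ _)).le
    rwa [le_div_iff₀ hM, mul_comm] at this
  have hmem : ∀ k < n + 1, natIdx w.2 k ∈ Wb := fun k hk => by
    rw [natIdx_of_lt w.2 hk]
    exact hdom.2 _ (Set.mem_univ _)
  rw [sum_smul_sub_sum_smul_eq hKstar hKlt hastar_sum]
  have h1 : ∀ k ∈ Finset.range Kstar,
      ‖mixWeights w.1 k • (F (natIdx w.2 k) - F (bstar k))‖ ≤ L * M * τ := by
    intro k hk
    rw [Finset.mem_range] at hk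
    have hle : ‖F (natIdx w.2 k) - F (bstar k)‖ ≤ L * (M * τ) :=
      (hLip k hk _ (hmem k (by omega)) ((hb k hk).trans hMτ)).trans
        (mul_le_mul_of_nonneg_left (hb k hk) hL.le)
    rw [norm_smul, Real.norm_of_nonneg (mixWeights_nonneg hdom.1 k), mul_assoc]
    exact (mul_le_of_le_one_left (norm_nonneg _)
      (mixWeights_le_one hdom.1 (by omega))).trans hle
  have h2 : ∀ i ∈ (Finset.univ : Finset (Fin n)), ‖(w.1 i - trueWeights Kstar astar i) •
      ((if (i : ℕ) + 1 < Kstar then F (bstar (i + 1)) else F (natIdx w.2 (i + 1))) -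
        F (bstar 0))‖ ≤ M * τ * (2 * D) := by
    intro i _
    rw [norm_smul, Real.norm_eq_abs]
    refine mul_le_mul (hu i) ?_ (norm_nonneg _) (by positivity)
    refine (norm_sub_le _ _).trans ?_
    have : ‖if (i : ℕ) + 1 < Kstar then F (bstar (i + 1)) else F (natIdx w.2 (i + 1))‖ ≤ D := by
      split_ifs with hi
      · exact hD _ (interior_subset (hbstar _ hi))
      · exact hD _ (hmem _ (by omega))
    linarith [hD _ hb0]
  refine (norm_add_le _ _).trans ((add_le_add (norm_sum_le_of_le _ h1)
    (norm_sum_le_of_le _ h2)).trans_eq ?_)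
  simp
  ring

/-- Some family of boxes shrinking to the true parameter avoids the zeros of the mixture error,
provided that either two true components differ or the first component is locally identifiable
with a linear rate. -/
theorem exists_mixBox_mixture_ne (hKstar : 1 ≤ Kstar) (hKlt : Kstar ≤ n)
    (hastar_pos : ∀ k < Kstar, 0 < astar k)
    (hastar_sum : ∑ k ∈ Finset.range Kstar, astar k = 1)
    (hbstar : ∀ k < Kstar, bstar k ∈ interior Wb)
    (hr : Metric.closedBall (bstar 0) r ⊆ Wb)
    (hD : ∀ b ∈ Wb, ‖F b‖ ≤ D) (hL : 0 < L) (hε₁ : 0 < ε₁)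
    (hLip : ∀ k < Kstar, ∀ b ∈ Wb, ‖b - bstar k‖ ≤ ε₁ →
      ‖F b - F (bstar k)‖ ≤ L * ‖b - bstar k‖)
    (hident : (∃ k < Kstar, F (bstar k) ≠ F (bstar 0)) ∨ (0 < d ∧ ∃ κ > 0, ∃ ε₀ > 0,
      ∀ b ∈ Wb, ‖b - bstar 0‖ ≤ ε₀ → κ * ‖b - bstar 0‖ ≤ ‖F b - F (bstar 0)‖)) :
    ∃ (α : Fin n → ℝ) (v : ℕ → EuclideanSpace ℝ (Fin d)) (β : ℝ), 0 < β ∧ (∀ i, 0 ≤ α i) ∧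
      (∀ i : Fin n, Kstar ≤ i + 1 → 0 < α i) ∧ ∃ τ₀ > 0, ∀ τ, 0 < τ → τ < τ₀ →
      ∀ w ∈ mixBox Kstar astar bstar α v β r τ,
        ∑ k ∈ Finset.range (n + 1), mixWeights w.1 k • F (natIdx w.2 k) ≠
          ∑ k ∈ Finset.range Kstar, astar k • F (bstar k) := by
  have hb0 : bstar 0 ∈ Wb := interior_subset (hbstar 0 hKstar)
  have hD0 : 0 ≤ D := (norm_nonneg _).trans (hD _ hb0)
  set N : ℝ := Kstar * L + n * (4 * D) + 1 with hN
  have hN0 : 0 < N := by positivity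
  have hcoef : ∀ w ∈ mixDomain n Wb, ∀ i : Fin n,
      ‖(if (i : ℕ) + 1 < Kstar then F (bstar (i + 1)) else F (natIdx w.2 (i + 1))) -
        F (bstar 0)‖ ≤ 2 * D := by
    intro w hw i
    refine (norm_sub_le _ _).trans ?_
    have : ‖if (i : ℕ) + 1 < Kstar then F (bstar (i + 1)) else F (natIdx w.2 (i + 1))‖ ≤ D := by
      split_ifs with hi
      · exact hD _ (interior_subset (hbstar _ hi))
      · refine hD _ ?_
        rw [natIdx_of_lt w.2 (by omega)]
        exact hw.2 _ (Set.mem_univ _)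
    linarith [hD _ hb0]
  have hdisp : ∀ w ∈ mixDomain n Wb, ∀ k < Kstar, ∀ t ≤ ε₁, ‖natIdx w.2 k - bstar k‖ ≤ t →
      ‖mixWeights w.1 k • (F (natIdx w.2 k) - F (bstar k))‖ ≤ L * t := by
    intro w hw k hk t ht hkt
    have hmem : natIdx w.2 k ∈ Wb := by
      rw [natIdx_of_lt w.2 (by omega : k < n + 1)]
      exact hw.2 _ (Set.mem_univ _)
    rw [norm_smul, Real.norm_of_nonneg (mixWeights_nonneg hw.1 k)]
    exact (mul_le_of_le_one_left (norm_nonneg _) (mixWeights_le_one hw.1 (by omega))).trans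
      ((hLip k hk _ hmem (hkt.trans ht)).trans (mul_le_mul_of_nonneg_left hkt hL.le))
  have hcenter : ∀ {α : Fin n → ℝ} {v : ℕ → EuclideanSpace ℝ (Fin d)} {β τ : ℝ},
      ∀ w ∈ mixBox Kstar astar bstar α v β r τ, ∀ k < Kstar,
      ‖natIdx w.2 k - bstar k - τ • v k‖ ≤ β * τ := by
    intro α v β τ w hw k hk
    have h := hw.2 ⟨k, by omega⟩ (Set.mem_univ _)
    simp only [hk, if_true, Metric.mem_closedBall, dist_eq_norm] at h
    rwa [natIdx_of_lt w.2 (by omega : k < n + 1), sub_sub]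
  rcases hident with ⟨k₁, hk₁, hne⟩ | ⟨hd, κ, hκ, ε₀, hε₀, hlow⟩
  · set Δ := ‖F (bstar k₁) - F (bstar 0)‖ with hΔ
    have hΔ0 : 0 < Δ := norm_pos_iff.2 (sub_ne_zero.2 hne)
    set ε := Δ / (2 * N) with hε
    have hε0 : 0 < ε := by positivity
    have hεN : ε * N = Δ / 2 := by rw [hε]; field_simp
    have hk₁0 : k₁ ≠ 0 := by rintro rfl; exact hne rfl
    obtain ⟨j, hj⟩ : ∃ j : Fin n, k₁ = j + 1 := ⟨⟨k₁ - 1, by omega⟩, by simp only; omega⟩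
    set α : Fin n → ℝ := fun i => if i = j then 1 else if Kstar ≤ i + 1 then ε else 0 with hα
    have hα0 : ∀ i, 0 ≤ α i := fun i => by simp only [hα]; split_ifs <;> positivity
    refine ⟨α, 0, ε, hε0, hα0, fun i hi => ?_, ?_⟩
    · simp only [hα]
      split_ifs <;> positivity
    obtain ⟨M, hM, τ₀, hτ₀, hbox⟩ := exists_mixBox_bounds (v := 0) hKstar hKlt
      hastar_pos hastar_sum hbstar hr hε0 hα0
    refine ⟨min τ₀ (ε₁ / ε), by positivity, fun τ hτ hτ' w hw heq => ?_⟩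
    obtain ⟨hdom, -, -, -, -⟩ := hbox τ hτ (hτ'.trans_le (min_le_left _ _)) w hw
    have hετ : ε * τ ≤ ε₁ := by
      have := (hτ'.trans_le (min_le_right _ _)).le
      rwa [le_div_iff₀ hε0, mul_comm] at this
    rw [← sub_eq_zero, sum_smul_sub_sum_smul_eq hKstar hKlt hastar_sum] at heq
    have h1 : ∀ k ∈ Finset.range Kstar,
        ‖mixWeights w.1 k • (F (natIdx w.2 k) - F (bstar k))‖ ≤ L * (ε * τ) := fun k hk => by
      rw [Finset.mem_range] at hk
      exact hdisp w hdom k hk _ hετ (by simpa using hcenter w hw k hk)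
    have h1' := norm_sum_le_of_le _ h1
    have h2 : ∀ i ∈ (Finset.univ : Finset (Fin n)), i ≠ j →
        ‖(w.1 i - trueWeights Kstar astar i) •
        ((if (i : ℕ) + 1 < Kstar then F (bstar (i + 1)) else F (natIdx w.2 (i + 1))) -
          F (bstar 0))‖ ≤ (2 * ε * τ) * (2 * D) := by
      intro i _ hij
      rw [norm_smul, Real.norm_eq_abs]
      refine mul_le_mul ?_ (hcoef w hdom i) (norm_nonneg _) (by positivity)
      have hwi := hw.1 i (Set.mem_univ i)
      have hαi : α i ≤ ε := by
        simp only [hα, if_neg hij]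
        split_ifs
        · exact le_rfl
        · exact hε0.le
      have h3 := mul_nonneg (hα0 i) hτ.le
      have h4 := mul_le_mul_of_nonneg_right hαi hτ.le
      have h5 := hwi.1
      have h6 := hwi.2
      rw [abs_le]
      constructor <;> linarith
    have h2' := Finset.norm_sum_sub_single_le (Finset.mem_univ j) (by positivity) h2
    have h3 : τ * Δ ≤ ‖(w.1 j - trueWeights Kstar astar j) •
        ((if (j : ℕ) + 1 < Kstar then F (bstar (j + 1)) else F (natIdx w.2 (j + 1))) -
          F (bstar 0))‖ := by
      have hwj := (hw.1 j (Set.mem_univ j)).1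
      simp only [hα, if_true, one_mul] at hwj
      rw [if_pos (hj ▸ hk₁), ← hj, norm_smul, Real.norm_eq_abs]
      refine mul_le_mul_of_nonneg_right (le_trans ?_ (le_abs_self _)) hΔ0.le
      linarith
    rw [add_comm, add_eq_zero_iff_eq_neg] at heq
    rw [heq] at h2'
    have h4 := norm_sub_norm_le
      ((w.1 j - trueWeights Kstar astar j) •
        ((if (j : ℕ) + 1 < Kstar then F (bstar (j + 1)) else F (natIdx w.2 (j + 1))) -
          F (bstar 0)))
      (-∑ k ∈ Finset.range Kstar, mixWeights w.1 k • (F (natIdx w.2 k) - F (bstar k)))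
    rw [norm_sub_rev, norm_neg] at h4
    simp only [Finset.sum_const, Finset.card_range, nsmul_eq_mul, Finset.card_univ,
      Fintype.card_fin] at h1' h2'
    have h5 : τ * Δ ≤ (ε * N) * τ - ε * τ := by
      rw [hN]
      linarith
    rw [hεN] at h5
    linarith [mul_pos hε0 hτ, mul_pos hΔ0 hτ]
  · have ha0 := hastar_pos 0 hKstar
    set Δ := astar 0 / 2 * κ / 2 with hΔ
    have hΔ0 : 0 < Δ := by positivity
    set ε := min (1 / 2) (Δ / (2 * N)) with hε
    have hε0 : 0 < ε := by positivity
    have hε2 : ε ≤ 1 / 2 := min_le_left _ _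
    have hεN : ε * N ≤ Δ / 2 := by
      calc ε * N ≤ Δ / (2 * N) * N := by gcongr; exact min_le_right _ _
        _ = Δ / 2 := by field_simp
    set e : EuclideanSpace ℝ (Fin d) := EuclideanSpace.single ⟨0, hd⟩ 1 with he
    have he1 : ‖e‖ = 1 := by simp [he]
    set α : Fin n → ℝ := fun i => if Kstar ≤ i + 1 then ε else 0 with hα
    have hα0 : ∀ i, 0 ≤ α i := fun i => by simp only [hα]; split_ifs <;> positivity
    set v : ℕ → EuclideanSpace ℝ (Fin d) := fun k => if k = 0 then e else 0 with hv
    refine ⟨α, v, ε, hε0, hα0, fun i hi => ?_, ?_⟩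
    · simp only [hα, if_pos hi]
      exact hε0
    obtain ⟨M, hM, τ₀, hτ₀, hbox⟩ := exists_mixBox_bounds (v := v) hKstar hKlt
      hastar_pos hastar_sum hbstar hr hε0 hα0
    refine ⟨min τ₀ (min (ε₁ / ε) (ε₀ / M)), by positivity, fun τ hτ hτ' w hw heq => ?_⟩
    obtain ⟨hdom, hhalf, -, hbM, -⟩ := hbox τ hτ (hτ'.trans_le (min_le_left _ _)) w hw
    have hετ : ε * τ ≤ ε₁ := by
      have := (hτ'.trans_le ((min_le_right _ _).trans (min_le_left _ _))).le
      rwa [le_div_iff₀ hε0, mul_comm] at this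
    have hMτ : M * τ ≤ ε₀ := by
      have := (hτ'.trans_le ((min_le_right _ _).trans (min_le_right _ _))).le
      rwa [le_div_iff₀ hM, mul_comm] at this
    rw [← sub_eq_zero, sum_smul_sub_sum_smul_eq hKstar hKlt hastar_sum] at heq
    have h1 : ∀ k ∈ Finset.range Kstar, k ≠ 0 →
        ‖mixWeights w.1 k • (F (natIdx w.2 k) - F (bstar k))‖ ≤ L * (ε * τ) := fun k hk hk0 => by
      rw [Finset.mem_range] at hk
      exact hdisp w hdom k hk _ hετ (by simpa [hv, hk0] using hcenter w hw k hk)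
    have h1' := Finset.norm_sum_sub_single_le (Finset.mem_range.2 hKstar) (by positivity) h1
    have h2 : ∀ i ∈ (Finset.univ : Finset (Fin n)),
        ‖(w.1 i - trueWeights Kstar astar i) •
        ((if (i : ℕ) + 1 < Kstar then F (bstar (i + 1)) else F (natIdx w.2 (i + 1))) -
          F (bstar 0))‖ ≤ (2 * ε * τ) * (2 * D) := by
      intro i _
      rw [norm_smul, Real.norm_eq_abs]
      refine mul_le_mul ?_ (hcoef w hdom i) (norm_nonneg _) (by positivity)
      have hwi := hw.1 i (Set.mem_univ i)
      have hαi : α i ≤ ε := by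
        simp only [hα]
        split_ifs
        · exact le_rfl
        · exact hε0.le
      have h3 := mul_nonneg (hα0 i) hτ.le
      have h4 := mul_le_mul_of_nonneg_right hαi hτ.le
      have h5 := hwi.1
      have h6 := hwi.2
      rw [abs_le]
      constructor <;> linarith
    have h2' := norm_sum_le_of_le _ h2
    have h3 : τ * Δ ≤ ‖mixWeights w.1 0 • (F (natIdx w.2 0) - F (bstar 0))‖ := by
      have hmem : natIdx w.2 0 ∈ Wb := by
        rw [natIdx_of_lt w.2 n.succ_pos]
        exact hdom.2 _ (Set.mem_univ _)
      have h4 := hcenter w hw 0 hKstar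
      have h5 : τ / 2 ≤ ‖natIdx w.2 0 - bstar 0‖ := by
        have h6 := norm_sub_norm_le (τ • e) (natIdx w.2 0 - bstar 0)
        rw [norm_sub_rev (τ • e), norm_smul, he1, Real.norm_of_nonneg hτ.le] at h6
        simp only [hv, if_true] at h4
        nlinarith
      have h6 := hlow _ hmem ((hbM 0 hKstar).trans hMτ)
      rw [norm_smul, Real.norm_of_nonneg (mixWeights_nonneg hdom.1 0)]
      calc τ * Δ = astar 0 / 2 * (κ * (τ / 2)) := by rw [hΔ]; ring
        _ ≤ _ := mul_le_mul (hhalf 0 hKstar)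
          ((mul_le_mul_of_nonneg_left h5 hκ.le).trans h6) (by positivity)
          (mixWeights_nonneg hdom.1 0)
    rw [add_eq_zero_iff_eq_neg] at heq
    rw [heq] at h1'
    have h4 := norm_sub_norm_le (mixWeights w.1 0 • (F (natIdx w.2 0) - F (bstar 0)))
      (-∑ i : Fin n, (w.1 i - trueWeights Kstar astar i) •
        ((if (i : ℕ) + 1 < Kstar then F (bstar (i + 1)) else F (natIdx w.2 (i + 1))) -
          F (bstar 0)))
    rw [norm_sub_rev, norm_neg] at h4
    simp only [Finset.sum_const, Finset.card_range, nsmul_eq_mul, Finset.card_univ,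
      Fintype.card_fin] at h1' h2'
    have h5 : τ * Δ ≤ (ε * N) * τ - ε * τ := by
      rw [hN]
      linarith
    linarith [mul_pos hε0 hτ, mul_pos hΔ0 hτ, mul_le_mul_of_nonneg_right hεN hτ.le]

end Mixture

section Density

variable {𝒳 : Type*} [MeasurableSpace 𝒳] {μ : Measure 𝒳}

theorem integrable_and_integral_eq_one_of_lintegral {g : 𝒳 → ℝ} (h0 : ∀ x, 0 ≤ g x)
    (hm : Measurable g) (h1 : ∫⁻ x, ENNReal.ofReal (g x) ∂μ = 1) :
    Integrable g μ ∧ ∫ x, g x ∂μ = 1 := by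
  refine ⟨⟨hm.aestronglyMeasurable, ?_⟩, ?_⟩
  · rw [hasFiniteIntegral_iff_ofReal (Filter.Eventually.of_forall h0), h1]
    exact ENNReal.one_lt_top
  · rw [integral_eq_lintegral_of_nonneg_ae (Filter.Eventually.of_forall h0)
      hm.aestronglyMeasurable, h1, ENNReal.toReal_one]

theorem L2_norm_sq_eq_integral_sq (X : Lp ℝ 2 μ) : ‖X‖ ^ 2 = ∫ x, (X x) ^ 2 ∂μ := by
  rw [← real_inner_self_eq_norm_sq, L2.inner_def]
  refine integral_congr_ae (Filter.Eventually.of_forall fun x => ?_)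
  simp [sq]

theorem Lp_coeFn_sum_smul {ι : Type*} (s : Finset ι) (c : ι → ℝ) (X : ι → Lp ℝ 2 μ)
    {g : ι → 𝒳 → ℝ} (hX : ∀ i ∈ s, X i =ᵐ[μ] g i) :
    (∑ i ∈ s, c i • X i : Lp ℝ 2 μ) =ᵐ[μ] fun x => ∑ i ∈ s, c i * g i x := by
  classical
  induction s using Finset.induction_on with
  | empty =>
    simp only [Finset.sum_empty]
    exact Lp.coeFn_zero ℝ 2 μ
  | insert a s ha ih =>
    rw [Finset.sum_insert ha]
    filter_upwards [Lp.coeFn_add (c a • X a) (∑ i ∈ s, c i • X i), Lp.coeFn_smul (c a) (X a),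
      hX a (Finset.mem_insert_self a s),
      ih fun i hi => hX i (Finset.mem_insert_of_mem hi)] with x h1 h2 h3 h4
    rw [h1, Pi.add_apply, h2, h4, Finset.sum_insert ha, Pi.smul_apply, h3, smul_eq_mul]

theorem integrable_sum_mul {ι : Type*} {s : Finset ι} {c : ι → ℝ} {g : ι → 𝒳 → ℝ}
    (hg : ∀ i ∈ s, Integrable (g i) μ ∧ ∫ x, g i x ∂μ = 1) (hc : ∑ i ∈ s, c i = 1) :
    Integrable (fun x => ∑ i ∈ s, c i * g i x) μ ∧ ∫ x, ∑ i ∈ s, c i * g i x ∂μ = 1 := by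
  have h : ∀ i ∈ s, Integrable (fun x => c i * g i x) μ := fun i hi => (hg i hi).1.const_mul _
  refine ⟨integrable_finsetSum _ h, ?_⟩
  rw [integral_finsetSum _ h, ← hc]
  refine Finset.sum_congr rfl fun i hi => ?_
  rw [integral_const_mul, (hg i hi).2, mul_one]

end Density

section Marginal

variable {𝒳 : Type*} [MeasurableSpace 𝒳] {μ : Measure 𝒳} {d n Kstar : ℕ}
  {Wb : Set (EuclideanSpace ℝ (Fin d))} {f : 𝒳 → EuclideanSpace ℝ (Fin d) → ℝ}
  {astar : ℕ → ℝ} {bstar : ℕ → EuclideanSpace ℝ (Fin d)}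
  {HX : (Fin n → ℝ) × (Fin (n + 1) → EuclideanSpace ℝ (Fin d)) → ℝ} {C₁ : ℝ}

/-- Any mixture of the true density and one component is a model density. -/
theorem exists_mixDomain_mixture_eq (hKstar : 1 ≤ Kstar) (hKlt : Kstar ≤ n)
    (hastar_pos : ∀ k < Kstar, 0 < astar k)
    (hastar_sum : ∑ k ∈ Finset.range Kstar, astar k = 1)
    (hbstar : ∀ k < Kstar, bstar k ∈ interior Wb) {b : EuclideanSpace ℝ (Fin d)} (hb : b ∈ Wb)
    {ε : ℝ} (hε0 : 0 < ε) (hε1 : ε < 1) :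
    ∃ w ∈ mixDomain n Wb, ∀ g : EuclideanSpace ℝ (Fin d) → ℝ,
      ∑ k ∈ Finset.range (n + 1), mixWeights w.1 k * g (natIdx w.2 k) =
        ε * ∑ k ∈ Finset.range Kstar, astar k * g (bstar k) + (1 - ε) * g b := by
  set j : Fin n := ⟨Kstar - 1, by omega⟩ with hj
  set B : Fin (n + 1) → EuclideanSpace ℝ (Fin d) := fun k =>
    if (k : ℕ) < Kstar then bstar k else b with hB
  set u : Fin n → ℝ := fun i => ε * trueWeights Kstar astar i + if i = j then 1 - ε else 0
    with hu
  have htrue : ∀ i : Fin n, 0 ≤ trueWeights Kstar astar i := fun i => by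
    rw [trueWeights]
    split_ifs with h
    · exact (hastar_pos _ h).le
    · exact le_rfl
  have hsum : ∑ i, u i = 1 - ε * astar 0 := by
    simp only [hu, Finset.sum_add_distrib, ← Finset.mul_sum,
      sum_trueWeights hKstar hKlt hastar_sum, Finset.sum_ite_eq', Finset.mem_univ, if_true]
    ring
  have hBidx : ∀ k < n + 1, natIdx B k = if k < Kstar then bstar k else b := fun k hk => by
    rw [natIdx_of_lt B hk]
  refine ⟨(u, B), ⟨⟨fun i => ?_, ?_⟩, fun k _ => ?_⟩, fun g => ?_⟩
  · refine add_nonneg (mul_nonneg hε0.le (htrue i)) ?_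
    split_ifs
    · linarith
    · exact le_rfl
  · rw [hsum]
    linarith [mul_pos hε0 (hastar_pos 0 hKstar)]
  · simp only [hB]
    split_ifs with h
    · exact interior_subset (hbstar _ h)
    · exact hb
  · have hq : ∑ k ∈ Finset.range Kstar, astar k * g (bstar k) = astar 0 * g (bstar 0) +
        ∑ i : Fin n, trueWeights Kstar astar i * g (natIdx B (i + 1)) := by
      have h := sum_range_succ_eq_fin (n := n) fun k =>
        if k < Kstar then astar k * g (bstar k) else 0
      rw [if_pos (by omega : 0 < Kstar)] at h
      have h' : ∑ k ∈ Finset.range Kstar, astar k * g (bstar k) =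
          ∑ k ∈ Finset.range (n + 1), if k < Kstar then astar k * g (bstar k) else 0 := by
        rw [← Finset.sum_filter]
        refine Finset.sum_congr ?_ fun _ _ => rfl
        ext k
        simp only [Finset.mem_filter, Finset.mem_range]
        omega
      rw [h', h]
      congr 1
      refine Finset.sum_congr rfl fun i _ => ?_
      rw [hBidx _ (by omega), trueWeights]
      split_ifs <;> simp
    have hjb : natIdx B (j + 1) = b := by
      rw [hBidx _ (by omega), if_neg]
      simp only [hj]
      omega
    rw [sum_range_succ_eq_fin fun k => mixWeights u k * g (natIdx B k), mixWeights_zero, hsum,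
      hBidx 0 (by omega), if_pos (by omega : 0 < Kstar), hq]
    simp_rw [mixWeights_succ]
    simp only [hu, add_mul, Finset.sum_add_distrib, ite_mul, zero_mul, Finset.sum_ite_eq',
      Finset.mem_univ, if_true, hjb, mul_add, Finset.mul_sum, mul_assoc]
    ring

/-- The bound on the marginal divergence forces every component to dominate the true density. -/
theorem ae_pos_and_integrable_component (hf_nonneg : ∀ x b, 0 ≤ f x b)
    (hf_meas : ∀ b, Measurable fun x => f x b)
    (hf_dens : ∀ b ∈ Wb, ∫⁻ x, ENNReal.ofReal (f x b) ∂μ = 1)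
    (hKstar : 1 ≤ Kstar) (hKlt : Kstar ≤ n) (hastar_pos : ∀ k < Kstar, 0 < astar k)
    (hastar_sum : ∑ k ∈ Finset.range Kstar, astar k = 1)
    (hbstar : ∀ k < Kstar, bstar k ∈ interior Wb)
    (hHX : ∀ w, HX w = ∫ x,
      (∑ k ∈ Finset.range Kstar, astar k * f x (bstar k)) *
        Real.log ((∑ k ∈ Finset.range Kstar, astar k * f x (bstar k)) /
          (∑ k ∈ Finset.range (n + 1), mixWeights w.1 k * f x (natIdx w.2 k))) ∂μ)
    (hC₁ : 0 < C₁)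
    (hHX_le : ∀ w ∈ mixDomain n Wb, HX w ≤ C₁ * ∫ x,
      ((∑ k ∈ Finset.range (n + 1), mixWeights w.1 k * f x (natIdx w.2 k)) -
        ∑ k ∈ Finset.range Kstar, astar k * f x (bstar k)) ^ 2 ∂μ)
    {b : EuclideanSpace ℝ (Fin d)} (hb : b ∈ Wb) :
    (∀ᵐ x ∂μ, 0 < ∑ k ∈ Finset.range Kstar, astar k * f x (bstar k) → 0 < f x b) ∧
      Integrable (fun x => (∑ k ∈ Finset.range Kstar, astar k * f x (bstar k)) *
        Real.log ((∑ k ∈ Finset.range Kstar, astar k * f x (bstar k)) / f x b)) μ := by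
  have hdens : ∀ b ∈ Wb, Integrable (fun x => f x b) μ ∧ ∫ x, f x b ∂μ = 1 := fun b hb =>
    integrable_and_integral_eq_one_of_lintegral (fun x => hf_nonneg x b) (hf_meas b)
      (hf_dens b hb)
  have hq := integrable_sum_mul (s := Finset.range Kstar) (c := astar)
    (g := fun k x => f x (bstar k)) (fun k hk =>
      hdens _ (interior_subset (hbstar k (Finset.mem_range.1 hk)))) hastar_sum
  refine ae_pos_and_integrable_of_mixture_bound
    (fun x => Finset.sum_nonneg fun k hk =>
      mul_nonneg (hastar_pos k (Finset.mem_range.1 hk)).le (hf_nonneg x _))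
    (fun x => hf_nonneg x b) hq.1 (hdens b hb).1
    (Finset.measurable_fun_sum _ fun k _ => (hf_meas _).const_mul _) (hf_meas b)
    (hq.2.trans (hdens b hb).2.symm)
    (D := C₁ * ∫ x, (f x b - ∑ k ∈ Finset.range Kstar, astar k * f x (bstar k)) ^ 2 ∂μ)
    fun ε h0 h1 => ?_
  obtain ⟨w, hw, hmix⟩ := exists_mixDomain_mixture_eq (n := n) hKstar hKlt hastar_pos hastar_sum
    hbstar hb h0 h1
  have h := hHX_le w hw
  rw [hHX] at h
  simp_rw [fun x => hmix (f x)] at h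
  refine h.trans (mul_le_mul_of_nonneg_left ?_ hC₁.le)
  have h2 : ∀ x, (ε * ∑ k ∈ Finset.range Kstar, astar k * f x (bstar k) + (1 - ε) * f x b -
      ∑ k ∈ Finset.range Kstar, astar k * f x (bstar k)) ^ 2 = (1 - ε) ^ 2 *
      (f x b - ∑ k ∈ Finset.range Kstar, astar k * f x (bstar k)) ^ 2 := fun x => by ring
  simp_rw [h2]
  rw [integral_const_mul]
  refine mul_le_of_le_one_left (integral_nonneg fun x => sq_nonneg _) ?_
  nlinarith

end Marginal

section MarginalThreshold

variable {𝒳 : Type*} [MeasurableSpace 𝒳] {μ : Measure 𝒳} {d n Kstar : ℕ}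
  {Wb : Set (EuclideanSpace ℝ (Fin d))} {f : 𝒳 → EuclideanSpace ℝ (Fin d) → ℝ}
  {astar : ℕ → ℝ} {bstar : ℕ → EuclideanSpace ℝ (Fin d)}
  {KLf : ℕ → EuclideanSpace ℝ (Fin d) → ℝ}
  {HX : (Fin n → ℝ) × (Fin (n + 1) → EuclideanSpace ℝ (Fin d)) → ℝ} {C₁ : ℝ}

/-- The density `f(·|b)` as an element of `L²(μ)` (junk value `0` if it is not in `L²`). -/
noncomputable def densityL2 (μ : Measure 𝒳) (f : 𝒳 → EuclideanSpace ℝ (Fin d) → ℝ)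
    (b : EuclideanSpace ℝ (Fin d)) : Lp ℝ 2 μ :=
  open Classical in if h : MemLp (fun x => f x b) 2 μ then h.toLp else 0

theorem densityL2_ae_eq {b : EuclideanSpace ℝ (Fin d)} (hm : Measurable fun x => f x b)
    (hi : Integrable (fun x => f x b ^ 2) μ) : densityL2 μ f b =ᵐ[μ] fun x => f x b := by
  have h : MemLp (fun x => f x b) 2 μ := (memLp_two_iff_integrable_sq hm.aestronglyMeasurable).2 hi
  rw [densityL2, dif_pos h]
  exact h.coeFn_toLp

theorem norm_sq_densityL2_mixture_sub (hf_meas : ∀ b, Measurable fun x => f x b)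
    (hfL2 : ∀ b ∈ Wb, Integrable (fun x => f x b ^ 2) μ) {s t : Finset ℕ} {c c' : ℕ → ℝ}
    {B B' : ℕ → EuclideanSpace ℝ (Fin d)} (hB : ∀ k ∈ s, B k ∈ Wb) (hB' : ∀ k ∈ t, B' k ∈ Wb) :
    ‖∑ k ∈ s, c k • densityL2 μ f (B k) - ∑ k ∈ t, c' k • densityL2 μ f (B' k)‖ ^ 2 =
      ∫ x, (∑ k ∈ s, c k * f x (B k) - ∑ k ∈ t, c' k * f x (B' k)) ^ 2 ∂μ := by
  rw [L2_norm_sq_eq_integral_sq]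
  refine integral_congr_ae ?_
  filter_upwards [Lp.coeFn_sub (∑ k ∈ s, c k • densityL2 μ f (B k))
      (∑ k ∈ t, c' k • densityL2 μ f (B' k)),
    Lp_coeFn_sum_smul s c (fun k => densityL2 μ f (B k))
      (fun k hk => densityL2_ae_eq (hf_meas _) (hfL2 _ (hB k hk))),
    Lp_coeFn_sum_smul t c' (fun k => densityL2 μ f (B' k))
      (fun k hk => densityL2_ae_eq (hf_meas _) (hfL2 _ (hB' k hk)))] with x h1 h2 h3
  rw [h1, Pi.sub_apply, h2, h3]

theorem norm_sq_densityL2_sub (hf_meas : ∀ b, Measurable fun x => f x b)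
    (hfL2 : ∀ b ∈ Wb, Integrable (fun x => f x b ^ 2) μ) {b b' : EuclideanSpace ℝ (Fin d)}
    (hb : b ∈ Wb) (hb' : b' ∈ Wb) :
    ‖densityL2 μ f b - densityL2 μ f b'‖ ^ 2 = ∫ x, (f x b - f x b') ^ 2 ∂μ := by
  simpa using norm_sq_densityL2_mixture_sub (s := {0}) (t := {0}) (c := 1) (c' := 1)
    (B := fun _ => b) (B' := fun _ => b') hf_meas hfL2 (by simpa) (by simpa)

theorem norm_sq_densityL2 (hf_meas : ∀ b, Measurable fun x => f x b)
    (hfL2 : ∀ b ∈ Wb, Integrable (fun x => f x b ^ 2) μ) {b : EuclideanSpace ℝ (Fin d)}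
    (hb : b ∈ Wb) : ‖densityL2 μ f b‖ ^ 2 = ∫ x, f x b ^ 2 ∂μ := by
  simpa using norm_sq_densityL2_mixture_sub (s := {0}) (t := ∅) (c := 1) (c' := 1)
    (B := fun _ => b) (B' := fun _ => b) hf_meas hfL2 (by simpa) (by simp)

theorem natIdx_mem_of_mem_mixDomain {w : (Fin n → ℝ) × (Fin (n + 1) → EuclideanSpace ℝ (Fin d))}
    (hw : w ∈ mixDomain n Wb) {k : ℕ} (hk : k < n + 1) : natIdx w.2 k ∈ Wb := by
  rw [natIdx_of_lt w.2 hk]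
  exact hw.2 _ (Set.mem_univ _)

/-- The marginal divergence is nonnegative, and vanishes only at the true density, where the
first component is present. -/
theorem marginal_nonneg_and_ae_eq (hf_nonneg : ∀ x b, 0 ≤ f x b)
    (hf_meas : ∀ b, Measurable fun x => f x b)
    (hf_dens : ∀ b ∈ Wb, ∫⁻ x, ENNReal.ofReal (f x b) ∂μ = 1)
    (hKstar : 1 ≤ Kstar) (hKlt : Kstar ≤ n) (hastar_pos : ∀ k < Kstar, 0 < astar k)
    (hastar_sum : ∑ k ∈ Finset.range Kstar, astar k = 1)
    (hbstar : ∀ k < Kstar, bstar k ∈ interior Wb)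
    (hHX : ∀ w, HX w = ∫ x,
      (∑ k ∈ Finset.range Kstar, astar k * f x (bstar k)) *
        Real.log ((∑ k ∈ Finset.range Kstar, astar k * f x (bstar k)) /
          (∑ k ∈ Finset.range (n + 1), mixWeights w.1 k * f x (natIdx w.2 k))) ∂μ)
    (hC₁ : 0 < C₁)
    (hHX_le : ∀ w ∈ mixDomain n Wb, HX w ≤ C₁ * ∫ x,
      ((∑ k ∈ Finset.range (n + 1), mixWeights w.1 k * f x (natIdx w.2 k)) -
        ∑ k ∈ Finset.range Kstar, astar k * f x (bstar k)) ^ 2 ∂μ)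
    {w : (Fin n → ℝ) × (Fin (n + 1) → EuclideanSpace ℝ (Fin d))} (hw : w ∈ mixDomain n Wb)
    (hw0 : 0 < mixWeights w.1 0) :
    0 ≤ HX w ∧ (HX w = 0 →
      (fun x => ∑ k ∈ Finset.range Kstar, astar k * f x (bstar k)) =ᵐ[μ]
        fun x => ∑ k ∈ Finset.range (n + 1), mixWeights w.1 k * f x (natIdx w.2 k)) := by
  have hdens : ∀ b ∈ Wb, Integrable (fun x => f x b) μ ∧ ∫ x, f x b ∂μ = 1 := fun b hb =>
    integrable_and_integral_eq_one_of_lintegral (fun x => hf_nonneg x b) (hf_meas b)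
      (hf_dens b hb)
  have hq := integrable_sum_mul (s := Finset.range Kstar) (c := astar)
    (g := fun k x => f x (bstar k)) (fun k hk =>
      hdens _ (interior_subset (hbstar k (Finset.mem_range.1 hk)))) hastar_sum
  have hp := integrable_sum_mul (s := Finset.range (n + 1)) (c := mixWeights w.1)
    (g := fun k x => f x (natIdx w.2 k)) (fun k hk =>
      hdens _ (natIdx_mem_of_mem_mixDomain hw (Finset.mem_range.1 hk))) (sum_mixWeights w.1)
  have hq0 : ∀ x, 0 ≤ ∑ k ∈ Finset.range Kstar, astar k * f x (bstar k) := fun x =>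
    Finset.sum_nonneg fun k hk =>
      mul_nonneg (hastar_pos k (Finset.mem_range.1 hk)).le (hf_nonneg x _)
  have hterm : ∀ x, ∀ k ∈ Finset.range (n + 1), 0 ≤ mixWeights w.1 k * f x (natIdx w.2 k) :=
    fun x k _ => mul_nonneg (mixWeights_nonneg hw.1 k) (hf_nonneg x _)
  have hle : ∀ x, mixWeights w.1 0 * f x (natIdx w.2 0) ≤
      ∑ k ∈ Finset.range (n + 1), mixWeights w.1 k * f x (natIdx w.2 k) := fun x =>
    Finset.single_le_sum (hterm x) (Finset.mem_range.2 n.succ_pos)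
  obtain ⟨hsupp, hmass⟩ := ae_pos_and_integrable_component hf_nonneg hf_meas hf_dens hKstar hKlt
    hastar_pos hastar_sum hbstar hHX hC₁ hHX_le (natIdx_mem_of_mem_mixDomain hw n.succ_pos)
  have hsupp' : ∀ᵐ x ∂μ, 0 < ∑ k ∈ Finset.range Kstar, astar k * f x (bstar k) →
      0 < ∑ k ∈ Finset.range (n + 1), mixWeights w.1 k * f x (natIdx w.2 k) := by
    filter_upwards [hsupp] with x hx hqx
    exact (mul_pos hw0 (hx hqx)).trans_le (hle x)
  have hp0 := fun x => Finset.sum_nonneg (hterm x)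
  rw [hHX w]
  refine ⟨integral_mul_log_div_nonneg hq0 hp0 hq.1 hp.1 (hq.2.trans hp.2.symm) hsupp',
    ae_eq_of_integral_mul_log_div_eq_zero hq0 hp0 hq.1 hp.1 (hq.2.trans hp.2.symm) hsupp' ?_⟩
  exact integrable_mul_log_div_of_le hq0 hp0 hq.1 hp.1
    (Finset.measurable_fun_sum _ fun k _ => (hf_meas _).const_mul _)
    (Finset.measurable_fun_sum _ fun k _ => (hf_meas _).const_mul _) hw0 hle hsupp hmass

theorem component_divergence_nonneg (hf_nonneg : ∀ x b, 0 ≤ f x b)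
    (hf_meas : ∀ b, Measurable fun x => f x b)
    (hf_dens : ∀ b ∈ Wb, ∫⁻ x, ENNReal.ofReal (f x b) ∂μ = 1)
    (hKstar : 1 ≤ Kstar) (hKlt : Kstar ≤ n) (hastar_pos : ∀ k < Kstar, 0 < astar k)
    (hastar_sum : ∑ k ∈ Finset.range Kstar, astar k = 1)
    (hbstar : ∀ k < Kstar, bstar k ∈ interior Wb)
    (hKLf : ∀ k < Kstar, ∀ b ∈ Wb,
      KLf k b = ∫ x, f x (bstar k) * Real.log (f x (bstar k) / f x b) ∂μ)
    (hHX : ∀ w, HX w = ∫ x,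
      (∑ k ∈ Finset.range Kstar, astar k * f x (bstar k)) *
        Real.log ((∑ k ∈ Finset.range Kstar, astar k * f x (bstar k)) /
          (∑ k ∈ Finset.range (n + 1), mixWeights w.1 k * f x (natIdx w.2 k))) ∂μ)
    (hC₁ : 0 < C₁)
    (hHX_le : ∀ w ∈ mixDomain n Wb, HX w ≤ C₁ * ∫ x,
      ((∑ k ∈ Finset.range (n + 1), mixWeights w.1 k * f x (natIdx w.2 k)) -
        ∑ k ∈ Finset.range Kstar, astar k * f x (bstar k)) ^ 2 ∂μ)
    {k : ℕ} (hk : k < Kstar) {b : EuclideanSpace ℝ (Fin d)} (hb : b ∈ Wb) : 0 ≤ KLf k b := by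
  have hdens : ∀ b ∈ Wb, Integrable (fun x => f x b) μ ∧ ∫ x, f x b ∂μ = 1 := fun b hb =>
    integrable_and_integral_eq_one_of_lintegral (fun x => hf_nonneg x b) (hf_meas b)
      (hf_dens b hb)
  have hk' := hdens _ (interior_subset (hbstar k hk))
  rw [hKLf k hk b hb]
  refine integral_mul_log_div_nonneg (fun x => hf_nonneg x _) (fun x => hf_nonneg x _) hk'.1
    (hdens b hb).1 (hk'.2.trans (hdens b hb).2.symm) ?_
  filter_upwards [(ae_pos_and_integrable_component hf_nonneg hf_meas hf_dens hKstar hKlt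
    hastar_pos hastar_sum hbstar hHX hC₁ hHX_le hb).1] with x hx hfx
  refine hx ((mul_pos (hastar_pos k hk) hfx).trans_le ?_)
  exact Finset.single_le_sum (f := fun k => astar k * f x (bstar k)) (fun j hj =>
    mul_nonneg (hastar_pos j (Finset.mem_range.1 hj)).le (hf_nonneg x _)) (Finset.mem_range.2 hk)

/-- If all true components coincide in `L²`, the divergence of the first component is controlled
by the `L²` distance. -/
theorem component_divergence_le_of_densityL2_eq (hf_meas : ∀ b, Measurable fun x => f x b)
    (hKstar : 1 ≤ Kstar)
    (hastar_sum : ∑ k ∈ Finset.range Kstar, astar k = 1)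
    (hbstar : ∀ k < Kstar, bstar k ∈ interior Wb)
    (hKLf : ∀ k < Kstar, ∀ b ∈ Wb,
      KLf k b = ∫ x, f x (bstar k) * Real.log (f x (bstar k) / f x b) ∂μ)
    (hHX : ∀ w, HX w = ∫ x,
      (∑ k ∈ Finset.range Kstar, astar k * f x (bstar k)) *
        Real.log ((∑ k ∈ Finset.range Kstar, astar k * f x (bstar k)) /
          (∑ k ∈ Finset.range (n + 1), mixWeights w.1 k * f x (natIdx w.2 k))) ∂μ)
    (hfL2 : ∀ b ∈ Wb, Integrable (fun x => f x b ^ 2) μ)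
    (hHX_le : ∀ w ∈ mixDomain n Wb, HX w ≤ C₁ * ∫ x,
      ((∑ k ∈ Finset.range (n + 1), mixWeights w.1 k * f x (natIdx w.2 k)) -
        ∑ k ∈ Finset.range Kstar, astar k * f x (bstar k)) ^ 2 ∂μ)
    (heq : ∀ k < Kstar, densityL2 μ f (bstar k) = densityL2 μ f (bstar 0))
    {b : EuclideanSpace ℝ (Fin d)} (hb : b ∈ Wb) :
    KLf 0 b ≤ C₁ * ‖densityL2 μ f b - densityL2 μ f (bstar 0)‖ ^ 2 := by
  have hW : ∀ k < Kstar, bstar k ∈ Wb := fun k hk => interior_subset (hbstar k hk)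
  have hq : ∀ᵐ x ∂μ, ∑ k ∈ Finset.range Kstar, astar k * f x (bstar k) = f x (bstar 0) := by
    have h1 := Lp_coeFn_sum_smul (Finset.range Kstar) astar (fun k => densityL2 μ f (bstar k))
      (fun k hk => densityL2_ae_eq (hf_meas _) (hfL2 _ (hW k (Finset.mem_range.1 hk))))
    rw [Finset.sum_congr rfl fun k hk => by rw [heq k (Finset.mem_range.1 hk)],
      ← Finset.sum_smul, hastar_sum, one_smul] at h1
    exact h1.symm.trans (densityL2_ae_eq (hf_meas _) (hfL2 _ (hW 0 hKstar)))
  set w : (Fin n → ℝ) × (Fin (n + 1) → EuclideanSpace ℝ (Fin d)) := (0, fun _ => b) with hwdef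
  have hw : w ∈ mixDomain n Wb := ⟨⟨fun _ => le_rfl, by simp [hwdef]⟩, fun _ _ => hb⟩
  have hp : ∀ x, ∑ k ∈ Finset.range (n + 1), mixWeights w.1 k * f x (natIdx w.2 k) = f x b := by
    intro x
    calc _ = ∑ k ∈ Finset.range (n + 1), mixWeights w.1 k * f x b :=
          Finset.sum_congr rfl fun k hk => by rw [natIdx_of_lt w.2 (Finset.mem_range.1 hk)]
      _ = f x b := by rw [← Finset.sum_mul, sum_mixWeights, one_mul]
  have h := hHX_le w hw
  rw [hHX] at h
  simp_rw [hp] at h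
  rw [hKLf 0 hKstar b hb, norm_sq_densityL2_sub hf_meas hfL2 hb (hW 0 hKstar)]
  convert h using 1
  · refine integral_congr_ae ?_
    filter_upwards [hq] with x hx
    rw [hx]
  · congr 1
    refine integral_congr_ae ?_
    filter_upwards [hq] with x hx
    rw [hx]

end MarginalThreshold

section MarginalThresholdBound

variable {𝒳 : Type*} [MeasurableSpace 𝒳] {μ : Measure 𝒳} {d n Kstar : ℕ}
  {Wb : Set (EuclideanSpace ℝ (Fin d))} {f : 𝒳 → EuclideanSpace ℝ (Fin d) → ℝ}
  {astar : ℕ → ℝ} {bstar : ℕ → EuclideanSpace ℝ (Fin d)}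
  {HX : (Fin n → ℝ) × (Fin (n + 1) → EuclideanSpace ℝ (Fin d)) → ℝ} {C₁ : ℝ}

/-- In dimension zero the model consists of the true density only. -/
theorem marginal_eq_zero_of_dim_zero (hd : d = 0)
    (hastar_sum : ∑ k ∈ Finset.range Kstar, astar k = 1)
    (hHX : ∀ w, HX w = ∫ x,
      (∑ k ∈ Finset.range Kstar, astar k * f x (bstar k)) *
        Real.log ((∑ k ∈ Finset.range Kstar, astar k * f x (bstar k)) /
          (∑ k ∈ Finset.range (n + 1), mixWeights w.1 k * f x (natIdx w.2 k))) ∂μ)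
    (w : (Fin n → ℝ) × (Fin (n + 1) → EuclideanSpace ℝ (Fin d))) : HX w = 0 := by
  subst hd
  rw [hHX]
  have h1 : ∀ x, ∑ k ∈ Finset.range Kstar, astar k * f x (bstar k) = f x 0 := fun x => by
    simp_rw [Subsingleton.elim _ (0 : EuclideanSpace ℝ (Fin 0))]
    rw [← Finset.sum_mul, hastar_sum, one_mul]
  have h2 : ∀ x, ∑ k ∈ Finset.range (n + 1), mixWeights w.1 k * f x (natIdx w.2 k) = f x 0 :=
    fun x => by
      simp_rw [fun k => Subsingleton.elim (natIdx w.2 k) (0 : EuclideanSpace ℝ (Fin 0))]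
      rw [← Finset.sum_mul, sum_mixWeights, one_mul]
  have h3 : ∀ x, f x 0 * Real.log (f x 0 / f x 0) = 0 := fun x => by
    rcases eq_or_ne (f x 0) 0 with h | h
    · rw [h, zero_mul]
    · rw [div_self h, Real.log_one, mul_zero]
  simp_rw [h1, h2, h3]
  exact integral_zero _ _

theorem setLIntegral_marginal_rpow_neg_eq_top (hd : 0 < d) (hWb : IsCompact Wb)
    (hf_nonneg : ∀ x b, 0 ≤ f x b)
    (hf_meas : ∀ b, Measurable fun x => f x b)
    (hf_dens : ∀ b ∈ Wb, ∫⁻ x, ENNReal.ofReal (f x b) ∂μ = 1)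
    (hKstar : 1 ≤ Kstar) (hKlt : Kstar ≤ n) (hastar_pos : ∀ k < Kstar, 0 < astar k)
    (hastar_sum : ∑ k ∈ Finset.range Kstar, astar k = 1)
    (hbstar : ∀ k < Kstar, bstar k ∈ interior Wb)
    {KLf : ℕ → EuclideanSpace ℝ (Fin d) → ℝ}
    (hKLf : ∀ k < Kstar, ∀ b ∈ Wb,
      KLf k b = ∫ x, f x (bstar k) * Real.log (f x (bstar k) / f x b) ∂μ)
    {ε₀ c₀ : ℝ} (hε₀ : 0 < ε₀) (hc₀ : 0 < c₀)
    (hquad : ∀ k < Kstar, ∀ b ∈ Wb, ‖b - bstar k‖ ≤ ε₀ → c₀ * ‖b - bstar k‖ ^ 2 ≤ KLf k b)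
    (hHX : ∀ w, HX w = ∫ x,
      (∑ k ∈ Finset.range Kstar, astar k * f x (bstar k)) *
        Real.log ((∑ k ∈ Finset.range Kstar, astar k * f x (bstar k)) /
          (∑ k ∈ Finset.range (n + 1), mixWeights w.1 k * f x (natIdx w.2 k))) ∂μ)
    (hfL2 : ∀ b ∈ Wb, Integrable (fun x => f x b ^ 2) μ)
    {Cf : ℝ} (hfL2_bdd : ∀ b ∈ Wb, ∫ x, f x b ^ 2 ∂μ ≤ Cf)
    {L ε₁ : ℝ} (hL : 0 < L) (hε₁ : 0 < ε₁)
    (hLip : ∀ k < Kstar, ∀ b ∈ Wb, ‖b - bstar k‖ ≤ ε₁ →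
      ∫ x, (f x b - f x (bstar k)) ^ 2 ∂μ ≤ L ^ 2 * ‖b - bstar k‖ ^ 2)
    (hC₁ : 0 < C₁)
    (hHX_le : ∀ w ∈ mixDomain n Wb, HX w ≤ C₁ * ∫ x,
      ((∑ k ∈ Finset.range (n + 1), mixWeights w.1 k * f x (natIdx w.2 k)) -
        ∑ k ∈ Finset.range Kstar, astar k * f x (bstar k)) ^ 2 ∂μ)
    {η : ℝ} (hη : 0 < η) {ψ : (Fin (n + 1) → EuclideanSpace ℝ (Fin d)) → ℝ}
    (hψ_cont : ContinuousOn ψ (Set.univ.pi fun _ => Wb))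
    (hψ_pos : ∀ b ∈ Set.univ.pi fun _ => Wb, 0 < ψ b) {s : ℝ} (hs : 0 < s)
    (hs' : ((n + 1 - Kstar : ℝ) * η + (Kstar - 1) + Kstar * d) / 2 < s) :
    ∫⁻ w in mixDomain n Wb, ENNReal.ofReal
      ((if HX w = 0 then 0 else HX w ^ (-s)) * mixPrior η ψ w) = ⊤ := by
  have hW : ∀ k < Kstar, bstar k ∈ Wb := fun k hk => interior_subset (hbstar k hk)
  obtain ⟨r, hr0, hr⟩ : ∃ r > 0, Metric.closedBall (bstar 0) r ⊆ Wb :=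
    Metric.nhds_basis_closedBall.mem_iff.1 (mem_interior_iff_mem_nhds.1 (hbstar 0 hKstar))
  have hD : ∀ b ∈ Wb, ‖densityL2 μ f b‖ ≤ √Cf := fun b hb => Real.le_sqrt_of_sq_le <| by
    rw [norm_sq_densityL2 hf_meas hfL2 hb]
    exact hfL2_bdd b hb
  have hLip' : ∀ k < Kstar, ∀ b ∈ Wb, ‖b - bstar k‖ ≤ ε₁ →
      ‖densityL2 μ f b - densityL2 μ f (bstar k)‖ ≤ L * ‖b - bstar k‖ := fun k hk b hb hbk => by
    refine le_of_sq_le_sq ?_ (by positivity)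
    rw [norm_sq_densityL2_sub hf_meas hfL2 hb (hW k hk), mul_pow]
    exact hLip k hk b hb hbk
  have hident : (∃ k < Kstar, densityL2 μ f (bstar k) ≠ densityL2 μ f (bstar 0)) ∨
      (0 < d ∧ ∃ κ > 0, ∃ ε₀ > 0, ∀ b ∈ Wb, ‖b - bstar 0‖ ≤ ε₀ →
        κ * ‖b - bstar 0‖ ≤ ‖densityL2 μ f b - densityL2 μ f (bstar 0)‖) := by
    by_cases h : ∃ k < Kstar, densityL2 μ f (bstar k) ≠ densityL2 μ f (bstar 0)
    · exact Or.inl h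
    · push Not at h
      refine Or.inr ⟨hd, √(c₀ / C₁), by positivity, ε₀, hε₀, fun b hb hbk => ?_⟩
      have h1 := (hquad 0 hKstar b hb hbk).trans (component_divergence_le_of_densityL2_eq hf_meas
        hKstar hastar_sum hbstar hKLf hHX hfL2 hHX_le h hb)
      refine le_of_sq_le_sq ?_ (norm_nonneg _)
      rw [mul_pow, Real.sq_sqrt (by positivity), div_mul_eq_mul_div, div_le_iff₀ hC₁]
      linarith
  obtain ⟨α, v, β, hβ, hα, hα_pos, τ₀, hτ₀, hne⟩ := exists_mixBox_mixture_ne hKstar hKlt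
    hastar_pos hastar_sum hbstar hr hD hL hε₁ hLip' hident
  obtain ⟨C, hC, τ₁, hτ₁, hle⟩ := exists_norm_mixture_sub_le_on_mixBox (v := v) hKstar hKlt
    hastar_pos hastar_sum hbstar hr hβ hα hD hL hε₁ hLip'
  obtain ⟨_, _, τ₂, hτ₂, hbox⟩ := exists_mixBox_bounds (v := v) hKstar hKlt
    hastar_pos hastar_sum hbstar hr hβ hα
  refine setLIntegral_eq_top_of_le_mixBox (α := α) (v := v) (β := β) (q := 2 * s)
    (c := (C₁ * C ^ 2) ^ (-s)) (τ₁ := min τ₀ (min τ₁ τ₂)) hKstar hKlt hastar_pos hastar_sum hWb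
    hbstar hr0 hr hβ hα hα_pos hη hψ_cont hψ_pos (by positivity) (by positivity)
    (fun τ hτ hτ' w hw => ?_) (by linarith)
  obtain ⟨hτ0, hτ1, hτ2⟩ : τ < τ₀ ∧ τ < τ₁ ∧ τ < τ₂ := by simpa using hτ'
  obtain ⟨hdom, hhalf, -⟩ := hbox τ hτ hτ2 w hw
  have hnorm := norm_sq_densityL2_mixture_sub (s := Finset.range (n + 1))
    (t := Finset.range Kstar) (c := mixWeights w.1) (c' := astar) (B := natIdx w.2) (B' := bstar)
    hf_meas hfL2 (fun k hk => natIdx_mem_of_mem_mixDomain hdom (Finset.mem_range.1 hk))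
    (fun k hk => hW k (Finset.mem_range.1 hk))
  obtain ⟨hnonneg, hzero⟩ := marginal_nonneg_and_ae_eq hf_nonneg hf_meas hf_dens hKstar hKlt
    hastar_pos hastar_sum hbstar hHX hC₁ hHX_le hdom
    ((half_pos (hastar_pos 0 hKstar)).trans_le (hhalf 0 hKstar))
  have hHne : HX w ≠ 0 := fun h => by
    refine hne τ hτ hτ0 w hw (sub_eq_zero.1 (norm_eq_zero.1 (pow_eq_zero_iff two_ne_zero |>.1 ?_)))
    rw [hnorm]
    refine integral_eq_zero_of_ae ?_
    filter_upwards [hzero h] with x hx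
    simp [hx]
  have hHle : HX w ≤ C₁ * C ^ 2 * τ ^ 2 := by
    refine (hHX_le w hdom).trans ?_
    rw [← hnorm, mul_assoc, ← mul_pow]
    exact mul_le_mul_of_nonneg_left (pow_le_pow_left₀ (norm_nonneg _) (hle τ hτ hτ1 w hw) 2) hC₁.le
  have hτs : τ ^ (-(2 * s)) = (τ ^ 2) ^ (-s) := by
    rw [← Real.rpow_natCast, ← Real.rpow_mul hτ.le]
    congr 1
    push_cast
    ring
  rw [if_neg hHne, hτs, ← Real.mul_rpow (by positivity) (by positivity)]
  exact Real.rpow_le_rpow_of_nonpos (lt_of_le_of_ne hnonneg hHne.symm) hHle (by linarith)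

theorem sSup_marginal_le (hWb : IsCompact Wb)
    (hf_nonneg : ∀ x b, 0 ≤ f x b)
    (hf_meas : ∀ b, Measurable fun x => f x b)
    (hf_dens : ∀ b ∈ Wb, ∫⁻ x, ENNReal.ofReal (f x b) ∂μ = 1)
    (hKstar : 1 ≤ Kstar) (hKlt : Kstar ≤ n) (hastar_pos : ∀ k < Kstar, 0 < astar k)
    (hastar_sum : ∑ k ∈ Finset.range Kstar, astar k = 1)
    (hbstar : ∀ k < Kstar, bstar k ∈ interior Wb)
    {KLf : ℕ → EuclideanSpace ℝ (Fin d) → ℝ}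
    (hKLf : ∀ k < Kstar, ∀ b ∈ Wb,
      KLf k b = ∫ x, f x (bstar k) * Real.log (f x (bstar k) / f x b) ∂μ)
    {ε₀ c₀ : ℝ} (hε₀ : 0 < ε₀) (hc₀ : 0 < c₀)
    (hquad : ∀ k < Kstar, ∀ b ∈ Wb, ‖b - bstar k‖ ≤ ε₀ → c₀ * ‖b - bstar k‖ ^ 2 ≤ KLf k b)
    (hHX : ∀ w, HX w = ∫ x,
      (∑ k ∈ Finset.range Kstar, astar k * f x (bstar k)) *
        Real.log ((∑ k ∈ Finset.range Kstar, astar k * f x (bstar k)) /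
          (∑ k ∈ Finset.range (n + 1), mixWeights w.1 k * f x (natIdx w.2 k))) ∂μ)
    (hfL2 : ∀ b ∈ Wb, Integrable (fun x => f x b ^ 2) μ)
    {Cf : ℝ} (hfL2_bdd : ∀ b ∈ Wb, ∫ x, f x b ^ 2 ∂μ ≤ Cf)
    {L ε₁ : ℝ} (hL : 0 < L) (hε₁ : 0 < ε₁)
    (hLip : ∀ k < Kstar, ∀ b ∈ Wb, ‖b - bstar k‖ ≤ ε₁ →
      ∫ x, (f x b - f x (bstar k)) ^ 2 ∂μ ≤ L ^ 2 * ‖b - bstar k‖ ^ 2)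
    (hC₁ : 0 < C₁)
    (hHX_le : ∀ w ∈ mixDomain n Wb, HX w ≤ C₁ * ∫ x,
      ((∑ k ∈ Finset.range (n + 1), mixWeights w.1 k * f x (natIdx w.2 k)) -
        ∑ k ∈ Finset.range Kstar, astar k * f x (bstar k)) ^ 2 ∂μ)
    {η : ℝ} (hη : 0 < η) {ψ : (Fin (n + 1) → EuclideanSpace ℝ (Fin d)) → ℝ}
    (hψ_cont : ContinuousOn ψ (Set.univ.pi fun _ => Wb))
    (hψ_pos : ∀ b ∈ Set.univ.pi fun _ => Wb, 0 < ψ b) {I : ℝ → ENNReal}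
    (hI : ∀ s : ℝ, I s = ∫⁻ w in mixDomain n Wb,
      ENNReal.ofReal ((if HX w = 0 then 0 else HX w ^ (-s)) * mixPrior η ψ w)) :
    sSup ({0} ∪ {s : ℝ | 0 < s ∧ I s < ⊤}) ≤
      ((n + 1 - Kstar : ℝ) * η + (Kstar - 1) + Kstar * d) / 2 := by
  have hK1 : (1 : ℝ) ≤ Kstar := by exact_mod_cast hKstar
  have hKn : (Kstar : ℝ) ≤ n := by exact_mod_cast hKlt
  have h0 : 0 ≤ ((n + 1 - Kstar : ℝ) * η + (Kstar - 1) + Kstar * d) / 2 := by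
    have : 0 ≤ (n + 1 - Kstar : ℝ) * η := mul_nonneg (by linarith) hη.le
    have : (0 : ℝ) ≤ Kstar * d := by positivity
    linarith
  rcases Nat.eq_zero_or_pos d with hd | hd
  · have hIs : ∀ s, I s = 0 := fun s => by
      rw [hI]
      simp [marginal_eq_zero_of_dim_zero hd hastar_sum hHX]
    rw [Real.sSup_of_not_bddAbove]
    · exact h0
    · rintro ⟨B, hB⟩
      have h1 := hB (Or.inr ⟨by positivity, by rw [hIs]; exact ENNReal.zero_lt_top⟩ :
        |B| + 1 ∈ {0} ∪ {s : ℝ | 0 < s ∧ I s < ⊤})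
      linarith [le_abs_self B]
  · refine sSup_le_of_eq_top h0 fun s hs hs' => ?_
    rw [hI]
    exact setLIntegral_marginal_rpow_neg_eq_top hd hWb hf_nonneg hf_meas hf_dens hKstar hKlt
      hastar_pos hastar_sum hbstar hKLf hε₀ hc₀ hquad hHX hfL2 hfL2_bdd hL hε₁ hLip hC₁ hHX_le hη
      hψ_cont hψ_pos hs hs'

end MarginalThresholdBound

section CompleteThresholdBound

variable {d n Kstar : ℕ} {astar : ℕ → ℝ} {bstar : ℕ → EuclideanSpace ℝ (Fin d)}
  {η : ℝ} {Wb : Set (EuclideanSpace ℝ (Fin d))}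
  {ψ : (Fin (n + 1) → EuclideanSpace ℝ (Fin d)) → ℝ}
  {KLf : ℕ → EuclideanSpace ℝ (Fin d) → ℝ}

theorem exists_forall_mul_sq_norm_sub_le (hWb : IsCompact Wb)
    (hKL : ∀ k < Kstar, ∀ b ∈ Wb, 0 ≤ KLf k b)
    (hcont : ∀ k < Kstar, ContinuousOn (KLf k) Wb)
    (hzero : ∀ k < Kstar, ∀ b ∈ Wb, (KLf k b = 0 ↔ b = bstar k))
    {ε₀ c₀ : ℝ} (hε₀ : 0 < ε₀) (hc₀ : 0 < c₀)
    (hquad : ∀ k < Kstar, ∀ b ∈ Wb, ‖b - bstar k‖ ≤ ε₀ → c₀ * ‖b - bstar k‖ ^ 2 ≤ KLf k b) :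
    ∃ c > 0, ∀ k < Kstar, ∀ b ∈ Wb, c * ‖b - bstar k‖ ^ 2 ≤ KLf k b := by
  have h : ∀ k < Kstar, ∃ c > 0, ∀ b ∈ Wb, c * ‖b - bstar k‖ ^ 2 ≤ KLf k b := fun k hk =>
    exists_mul_sq_norm_sub_le_of_isCompact hWb (hcont k hk)
      (fun b hb hne => lt_of_le_of_ne (hKL k hk b hb) fun h => hne ((hzero k hk b hb).1 h.symm))
      hε₀ hc₀ (hquad k hk)
  clear hquad hzero hcont hKL
  induction Kstar with
  | zero => exact ⟨1, one_pos, fun k hk => absurd hk k.not_lt_zero⟩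
  | succ m ih =>
    obtain ⟨c, hc, hcm⟩ := ih fun k hk => h k (hk.trans m.lt_succ_self)
    obtain ⟨c', hc', hcm'⟩ := h m m.lt_succ_self
    refine ⟨min c c', lt_min hc hc', fun k hk b hb => ?_⟩
    rcases Nat.lt_succ_iff_lt_or_eq.1 hk with hk | rfl
    · exact (mul_le_mul_of_nonneg_right (min_le_left _ _) (sq_nonneg _)).trans (hcm k hk b hb)
    · exact (mul_le_mul_of_nonneg_right (min_le_right _ _) (sq_nonneg _)).trans (hcm' b hb)

theorem le_sSup_mixHXY (hKstar : 1 ≤ Kstar) (hKlt : Kstar ≤ n)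
    (hastar_pos : ∀ k < Kstar, 0 < astar k)
    (hastar_sum : ∑ k ∈ Finset.range Kstar, astar k = 1) (hWb : IsCompact Wb)
    (hbstar : ∀ k < Kstar, bstar k ∈ interior Wb)
    (hKL : ∀ k < Kstar, ∀ b ∈ Wb, 0 ≤ KLf k b)
    (hcont : ∀ k < Kstar, ContinuousOn (KLf k) Wb)
    (hzero : ∀ k < Kstar, ∀ b ∈ Wb, (KLf k b = 0 ↔ b = bstar k))
    {ε₀ c₀ C₀ : ℝ} (hε₀ : 0 < ε₀) (hc₀ : 0 < c₀) (hC₀ : 0 < C₀)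
    (hquad : ∀ k < Kstar, ∀ b ∈ Wb, ‖b - bstar k‖ ≤ ε₀ →
      c₀ * ‖b - bstar k‖ ^ 2 ≤ KLf k b ∧ KLf k b ≤ C₀ * ‖b - bstar k‖ ^ 2)
    (hη : 0 < η) (hψ_cont : ContinuousOn ψ (Set.univ.pi fun _ => Wb))
    (hψ_pos : ∀ b ∈ Set.univ.pi fun _ => Wb, 0 < ψ b) {I : ℝ → ENNReal}
    (hI : ∀ s : ℝ, I s = ∫⁻ w in mixDomain n Wb,
      ENNReal.ofReal
        ((if (∀ k < Kstar, 0 < mixWeights w.1 k) ∧ mixHXY Kstar astar KLf w ≠ 0 then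
            mixHXY Kstar astar KLf w ^ (-s)
          else 0) * mixPrior η ψ w)) :
    (n + 1 - Kstar : ℝ) * η + (Kstar - 1) / 2 + Kstar * d / 2 ≤
      sSup ({0} ∪ {s : ℝ | 0 < s ∧ I s < ⊤}) := by
  have hK1 : (1 : ℝ) ≤ Kstar := by exact_mod_cast hKstar
  have hKn : (Kstar : ℝ) ≤ n := by exact_mod_cast hKlt
  obtain ⟨c, hc, hle⟩ := exists_forall_mul_sq_norm_sub_le hWb hKL hcont hzero hε₀ hc₀
    fun k hk b hb hbk => (hquad k hk b hb hbk).1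
  refine le_sSup_of_lt_top_of_eq_top (u := (n + 1 - Kstar : ℝ) * η + (Kstar - 1) + Kstar * d)
    ?_ (fun s hs hs' => ?_) (fun s hs hs' => ?_)
  · have : 0 < (n + 1 - Kstar : ℝ) * η := mul_pos (by linarith) hη
    have : (0 : ℝ) ≤ Kstar * d := by positivity
    linarith
  · rw [hI]
    exact setLIntegral_mixHXY_rpow_neg_lt_top hKstar hKlt hastar_pos hastar_sum hWb hc hle hη
      hψ_cont hs hs'
  · rw [hI]
    exact setLIntegral_mixHXY_rpow_neg_eq_top hKstar hKlt hastar_pos hastar_sum hWb hbstar hKL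
      hε₀ hC₀ (fun k hk b hb hbk => (hquad k hk b hb hbk).2) hη hψ_cont hψ_pos hs hs'

end CompleteThresholdBound

/-- the log-canonical thresholds
`λ_XY = sup({0} ∪ {s > 0 : ∫ H_XY^{−s}φ < ∞})` and
`λ_X = sup({0} ∪ {s > 0 : ∫ H_X^{−s}φ < ∞})` (minus the largest poles of `ζ_XY`, `ζ_X`)
satisfy `λ_XY − λ_X ≥ (K−K*)η₁/2 > 0` — the coefficient of `(ln n)/n` in the lower bound
for the Bayes latent-variable estimation error of the mixture model. Here `K = n+1`. -/
theorem mixture_latent_variable_error_coefficient_lower_bound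
    {𝒳 : Type*} [MeasurableSpace 𝒳] (μ : Measure 𝒳) [SigmaFinite μ]
    (d_c : ℕ) (Wb : Set (EuclideanSpace ℝ (Fin d_c))) (hWb : IsCompact Wb)
    (f : 𝒳 → EuclideanSpace ℝ (Fin d_c) → ℝ)
    (hf_nonneg : ∀ x b, 0 ≤ f x b) (hf_meas : ∀ b, Measurable fun x => f x b)
    (hf_dens : ∀ b ∈ Wb, ∫⁻ x, ENNReal.ofReal (f x b) ∂μ = 1)
    (Kstar n : ℕ) (hKstar : 1 ≤ Kstar) (hKlt : Kstar ≤ n)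
    (astar : ℕ → ℝ) (hastar_pos : ∀ k < Kstar, 0 < astar k)
    (hastar_sum : ∑ k ∈ Finset.range Kstar, astar k = 1)
    (bstar : ℕ → EuclideanSpace ℝ (Fin d_c))
    (hbstar : ∀ k < Kstar, bstar k ∈ interior Wb)
    -- the component Kullback–Leibler divergence KLf(b*_k, b)
    (KLf : ℕ → EuclideanSpace ℝ (Fin d_c) → ℝ)
    (hKLf : ∀ k < Kstar, ∀ b ∈ Wb,
      KLf k b = ∫ x, f x (bstar k) * Real.log (f x (bstar k) / f x b) ∂μ)
    (hKLf_cont : ∀ k < Kstar, ContinuousOn (KLf k) Wb)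
    (hKLf_zero : ∀ k < Kstar, ∀ b ∈ Wb, (KLf k b = 0 ↔ b = bstar k))
    (ε₀ c₀ C₀ : ℝ) (hε₀ : 0 < ε₀) (hc₀ : 0 < c₀) (hC₀ : 0 < C₀)
    (hKLf_quad : ∀ k < Kstar, ∀ b ∈ Wb, ‖b - bstar k‖ ≤ ε₀ →
      c₀ * ‖b - bstar k‖ ^ 2 ≤ KLf k b ∧ KLf k b ≤ C₀ * ‖b - bstar k‖ ^ 2)
    -- the marginal Kullback–Leibler divergence H_X(a,b) = ∫ q ln(q/p(·|a,b)) dμ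
    (HX : (Fin n → ℝ) × (Fin (n + 1) → EuclideanSpace ℝ (Fin d_c)) → ℝ)
    (hHX : ∀ w, HX w = ∫ x,
      (∑ k ∈ Finset.range Kstar, astar k * f x (bstar k)) *
        Real.log ((∑ k ∈ Finset.range Kstar, astar k * f x (bstar k)) /
          (∑ k ∈ Finset.range (n + 1), mixWeights w.1 k * f x (natIdx w.2 k))) ∂μ)
    -- (i) the components are in L²(μ), with uniformly bounded L² norm
    (hfL2 : ∀ b ∈ Wb, Integrable (fun x => f x b ^ 2) μ)
    (Cf : ℝ) (hfL2_bdd : ∀ b ∈ Wb, ∫ x, f x b ^ 2 ∂μ ≤ Cf)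
    -- (ii) local L² Lipschitz continuity of b ↦ f(·|b) at each b*_k
    (L ε₁ : ℝ) (hL : 0 < L) (hε₁ : 0 < ε₁)
    (hLip : ∀ k < Kstar, ∀ b ∈ Wb, ‖b - bstar k‖ ≤ ε₁ →
      Integrable (fun x => (f x b - f x (bstar k)) ^ 2) μ ∧
      ∫ x, (f x b - f x (bstar k)) ^ 2 ∂μ ≤ L ^ 2 * ‖b - bstar k‖ ^ 2)
    -- (iii) H_X is bounded by the squared L² distance
    (C₁ : ℝ) (hC₁ : 0 < C₁)
    (hHX_le : ∀ w ∈ mixDomain n Wb, HX w ≤ C₁ * ∫ x,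
      ((∑ k ∈ Finset.range (n + 1), mixWeights w.1 k * f x (natIdx w.2 k)) -
        ∑ k ∈ Finset.range Kstar, astar k * f x (bstar k)) ^ 2 ∂μ)
    -- the prior
    (η₁ : ℝ) (hη₁ : 0 < η₁)
    (ψ : (Fin (n + 1) → EuclideanSpace ℝ (Fin d_c)) → ℝ)
    (hψ_cont : ContinuousOn ψ (Set.univ.pi fun _ => Wb))
    (hψ_pos : ∀ b ∈ Set.univ.pi fun _ => Wb, 0 < ψ b)
    -- the integrals ∫ H^{−s} φ over Δ_K × W_b^K, with H^{−s} := 0 where H ∈ {0,+∞}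
    (IXY IX : ℝ → ENNReal)
    (hIXY : ∀ s : ℝ, IXY s = ∫⁻ w in mixDomain n Wb,
      ENNReal.ofReal
        ((if (∀ k < Kstar, 0 < mixWeights w.1 k) ∧ mixHXY Kstar astar KLf w ≠ 0 then
            mixHXY Kstar astar KLf w ^ (-s)
          else 0) * mixPrior η₁ ψ w))
    (hIX : ∀ s : ℝ, IX s = ∫⁻ w in mixDomain n Wb,
      ENNReal.ofReal ((if HX w = 0 then 0 else HX w ^ (-s)) * mixPrior η₁ ψ w))
    -- the log-canonical thresholds
    (lamXY lamX : ℝ)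
    (hlamXY : lamXY = sSup ({0} ∪ {s : ℝ | 0 < s ∧ IXY s < ⊤}))
    (hlamX : lamX = sSup ({0} ∪ {s : ℝ | 0 < s ∧ IX s < ⊤})) :
    ((n + 1 : ℝ) - Kstar) * η₁ / 2 ≤ lamXY - lamX ∧
    0 < ((n + 1 : ℝ) - Kstar) * η₁ / 2 := by
  have hKL : ∀ k < Kstar, ∀ b ∈ Wb, 0 ≤ KLf k b := fun k hk b hb =>
    component_divergence_nonneg hf_nonneg hf_meas hf_dens hKstar hKlt hastar_pos hastar_sum hbstar
      hKLf hHX hC₁ hHX_le hk hb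
  have hXY := le_sSup_mixHXY hKstar hKlt hastar_pos hastar_sum hWb hbstar hKL hKLf_cont hKLf_zero
    hε₀ hc₀ hC₀ hKLf_quad hη₁ hψ_cont hψ_pos hIXY
  have hX := sSup_marginal_le hWb hf_nonneg hf_meas hf_dens hKstar hKlt hastar_pos hastar_sum
    hbstar hKLf hε₀ hc₀ (fun k hk b hb hbk => (hKLf_quad k hk b hb hbk).1) hHX hfL2 hfL2_bdd hL
    hε₁ (fun k hk b hb hbk => (hLip k hk b hb hbk).2) hC₁ hHX_le hη₁ hψ_cont hψ_pos hIX
  rw [← hlamXY] at hXY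
  rw [← hlamX] at hX
  have hKn : (Kstar : ℝ) ≤ n := by exact_mod_cast hKlt
  have hpos : 0 < ((n + 1 : ℝ) - Kstar) * η₁ := mul_pos (by linarith) hη₁
  constructor <;> linarith
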